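/- arXiv:0803.0461 — 2 statements merged into one kernel-verified Lean document; each statement's English description precedes it below -/
import Mathlib

section
/- Let R be a commutative Noetherian ring, 𝔞 an ideal of R, and M a nonzero finitely generated R-module. Define ht_M(𝔞) := inf{ dim M_𝔭 : 𝔭 ∈ Supp_R(M) ∩ V(𝔞) }, where dim M_𝔭 is the Krull dimension of the R_𝔭-module M_𝔭. If 0 < ht_M(𝔞) < ∞, then for t := ht_M(𝔞) the local cohomology module H^t_𝔞(M) is not finitely generated; in particular the finiteness dimension f_𝔞(M) satisfies f_𝔞(M) ≤ ht_M(𝔞). -/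
/-!
STATEMENT 4: Let R be a commutative Noetherian ring, 𝔞 an ideal of R, and M a nonzero finitely
generated R-module. Define ht_M(𝔞) := inf{ dim M_𝔭 : 𝔭 ∈ Supp_R(M) ∩ V(𝔞) }, where dim M_𝔭 is
the Krull dimension of the R_𝔭-module M_𝔭. If 0 < ht_M(𝔞) < ∞, then for t := ht_M(𝔞) the module
H^t_𝔞(M) is not finitely generated (in particular f_𝔞(M) ≤ ht_M(𝔞)).

The hypothesis `0 < ht_M(𝔞) < ∞` is encoded by `t : ℕ`, `0 < t`, and `(t : WithBot ℕ∞)` equal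
to the infimum defining `ht_M(𝔞)`.  The dimension of a module is the Krull dimension of its
support.
-/

open CategoryTheory Opposite

universe u

/-- The Krull dimension of an `R`-module `M`, i.e. the Krull dimension of its support. -/
noncomputable def moduleKrullDim (R : Type u) [CommRing R]
    (M : Type u) [AddCommGroup M] [Module R M] : WithBot ℕ∞ :=
  Order.krullDim ↥(Module.support R M)

/-- `ht_M(𝔞) = inf { dim_{R_𝔭} M_𝔭 : 𝔭 ∈ Supp M ∩ V(𝔞) }`. -/
noncomputable def moduleHeight (R : Type u) [CommRing R]
    (M : Type u) [AddCommGroup M] [Module R M] (𝔞 : Ideal R) : WithBot ℕ∞ :=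
  sInf { d : WithBot ℕ∞ | ∃ 𝔭 ∈ Module.support R M, 𝔞 ≤ 𝔭.asIdeal ∧
    d = moduleKrullDim (Localization.AtPrime 𝔭.asIdeal) (LocalizedModule 𝔭.asIdeal.primeCompl M) }

namespace CategoryTheory.ProjectiveResolution

variable {R : Type u} [CommRing R] {X X' : ModuleCat.{u} R}

/-- The module of `n`-cocycles of `Hom(P, Y)` for a projective resolution `P`. -/
noncomputable def cocycles (P : ProjectiveResolution X) (Y : ModuleCat.{u} R) (n : ℕ) :
    Submodule R (P.complex.X n ⟶ Y) :=
  LinearMap.ker (Linear.leftComp R Y (P.complex.d (n + 1) n))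

lemma mem_cocycles (P : ProjectiveResolution X) (Y : ModuleCat.{u} R) (n : ℕ)
    (f : P.complex.X n ⟶ Y) : f ∈ P.cocycles Y n ↔ P.complex.d (n + 1) n ≫ f = 0 := Iff.rfl

/-- The map from cocycles to `Abelian.Ext`. -/
noncomputable def cocyclesToExt (P : ProjectiveResolution X) (Y : ModuleCat.{u} R) (n : ℕ) :
    P.cocycles Y n →ₗ[R] Abelian.Ext X Y n where
  toFun f := P.extMk f.1 (n + 1) rfl f.2
  map_add' f g := (P.add_extMk _ _ _ _ f.2 g.2).symm
  map_smul' r f := by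
    have h := P.extMk_comp_mk₀ f.1 (n + 1) rfl f.2 (r • 𝟙 Y)
    rw [Abelian.Ext.smul_eq_comp_mk₀, RingHom.id_apply, h]
    congr 1

/-- The inclusion of cocycles into the degree `n` part of `Hom(P, Y)`. -/
noncomputable def cocyclesInclusion (P : ProjectiveResolution X) (Y : ModuleCat.{u} R) (n : ℕ) :
    ModuleCat.of R (P.cocycles Y n) ⟶ (P.complex.linearYonedaObj R Y).X n :=
  ModuleCat.ofHom (Submodule.subtype (P.cocycles Y n))

/-- The identification of cocycles with the categorical cycles of `Hom(P, Y)`. -/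
noncomputable def cocyclesToCycles (P : ProjectiveResolution X) (Y : ModuleCat.{u} R) (n : ℕ) :
    ModuleCat.of R (P.cocycles Y n) ⟶ (P.complex.linearYonedaObj R Y).cycles n :=
  (P.complex.linearYonedaObj R Y).liftCycles (P.cocyclesInclusion Y n) (n + 1) (by simp)
    (by ext f : 2; exact f.2)

lemma cocyclesToCycles_i (P : ProjectiveResolution X) (Y : ModuleCat.{u} R) (n : ℕ) :
    P.cocyclesToCycles Y n ≫ (P.complex.linearYonedaObj R Y).iCycles n =
      P.cocyclesInclusion Y n :=
  HomologicalComplex.liftCycles_i _ _ _ _ _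

lemma iCycles_injective (P : ProjectiveResolution X) (Y : ModuleCat.{u} R) (n : ℕ) :
    Function.Injective ((P.complex.linearYonedaObj R Y).iCycles n) :=
  (ModuleCat.mono_iff_injective _).1 inferInstance

/-- The map from cocycles to the left derived functors of `Hom(-, Y)`. -/
noncomputable def cocyclesToLeftDerived (P : ProjectiveResolution X) (Y : ModuleCat.{u} R) (n : ℕ) :
    ModuleCat.of R (P.cocycles Y n) ⟶ ((Ext R (ModuleCat.{u} R) n).obj (op X)).obj Y :=
  P.cocyclesToCycles Y n ≫
    (P.complex.linearYonedaObj R Y).homologyπ n ≫ (P.isoExt n Y).inv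

lemma cocyclesToExt_surjective (P : ProjectiveResolution X) (Y : ModuleCat.{u} R) (n : ℕ) :
    Function.Surjective (P.cocyclesToExt Y n) := fun α ↦ by
  obtain ⟨f, hf, rfl⟩ := P.extMk_surjective α (n + 1) rfl
  exact ⟨⟨f, hf⟩, rfl⟩

lemma cocyclesToExt_eq_zero_iff (P : ProjectiveResolution X) (Y : ModuleCat.{u} R) (n : ℕ)
    (f : P.cocycles Y (n + 1)) : P.cocyclesToExt Y (n + 1) f = 0 ↔
      ∃ g : P.complex.X n ⟶ Y, P.complex.d (n + 1) n ≫ g = f.1 :=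
  P.extMk_eq_zero_iff f.1 _ rfl f.2 n rfl

lemma cocyclesToLeftDerived_surjective (P : ProjectiveResolution X) (Y : ModuleCat.{u} R) (n : ℕ) :
    Function.Surjective (P.cocyclesToLeftDerived Y n) := fun α ↦ by
  obtain ⟨z, hz⟩ := (ModuleCat.epi_iff_surjective
    ((P.complex.linearYonedaObj R Y).homologyπ n)).1 inferInstance ((P.isoExt n Y).hom α)
  have hz' : P.complex.d (n + 1) n ≫
      ((P.complex.linearYonedaObj R Y).iCycles n z : P.complex.X n ⟶ Y) = 0 :=
    congr($((P.complex.linearYonedaObj R Y).iCycles_d n (n + 1)) z)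
  refine ⟨⟨(P.complex.linearYonedaObj R Y).iCycles n z, hz'⟩, ?_⟩
  have : P.cocyclesToCycles Y n ⟨(P.complex.linearYonedaObj R Y).iCycles n z, hz'⟩ = z :=
    P.iCycles_injective Y n congr($(P.cocyclesToCycles_i Y n) ⟨_, hz'⟩)
  simp only [cocyclesToLeftDerived, ConcreteCategory.comp_apply]
  rw [this, hz]
  simp

lemma cocyclesToLeftDerived_eq_zero_iff (P : ProjectiveResolution X) (Y : ModuleCat.{u} R) (n : ℕ)
    (f : P.cocycles Y (n + 1)) : P.cocyclesToLeftDerived Y (n + 1) f = 0 ↔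
      ∃ g : P.complex.X n ⟶ Y, P.complex.d (n + 1) n ≫ g = f.1 := by
  set K := P.complex.linearYonedaObj R Y
  have hzi : K.iCycles (n + 1) (P.cocyclesToCycles Y (n + 1) f) = f.1 :=
    congr($(P.cocyclesToCycles_i Y (n + 1)) f)
  have h1 : P.cocyclesToLeftDerived Y (n + 1) f = 0 ↔
      K.homologyπ (n + 1) (P.cocyclesToCycles Y (n + 1) f) = 0 := by
    have hinj := (ModuleCat.mono_iff_injective (P.isoExt (R := R) (n + 1) Y).inv).1 inferInstance
    exact (map_eq_zero_iff (P.isoExt (R := R) (n + 1) Y).inv.hom hinj)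
  have hex : (ShortComplex.mk (K.toCycles n (n + 1)) (K.homologyπ (n + 1)) (by simp)).Exact :=
    ShortComplex.exact_of_g_is_cokernel _ (K.homologyIsCokernel n (n + 1) (by simp))
  rw [h1]
  constructor
  · intro h
    obtain ⟨g, hg⟩ := (ShortComplex.moduleCat_exact_iff _).1 hex _ h
    refine ⟨g, ?_⟩
    rw [← hzi]
    erw [← hg]
    exact congr($(K.toCycles_i n (n + 1)) g).symm
  · rintro ⟨g, hg⟩
    have : K.toCycles n (n + 1) g = P.cocyclesToCycles Y (n + 1) f := by
      apply P.iCycles_injective Y (n + 1)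
      rw [hzi, ← hg]
      exact congr($(K.toCycles_i n (n + 1)) g)
    rw [← this]
    exact congr($(K.toCycles_comp_homologyπ n (n + 1)) g)

/-- Precomposition of cocycles with a morphism of resolutions. -/
noncomputable def cocyclesMap {P : ProjectiveResolution X} {P' : ProjectiveResolution X'}
    {g : X' ⟶ X} (φ : Hom P' P g) (Y : ModuleCat.{u} R) (n : ℕ) :
    P.cocycles Y n →ₗ[R] P'.cocycles Y n :=
  (Linear.leftComp R Y (φ.hom.f n)).restrict fun f hf ↦ by
    rw [mem_cocycles] at hf ⊢
    simp [← φ.hom.comm_assoc, hf]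

lemma cocyclesToExt_naturality {P : ProjectiveResolution X} {P' : ProjectiveResolution X'}
    {g : X' ⟶ X} (φ : Hom P' P g) (Y : ModuleCat.{u} R) (n : ℕ) (f : P.cocycles Y n) :
    P'.cocyclesToExt Y n (cocyclesMap φ Y n f) =
      (Abelian.Ext.mk₀ g).comp (P.cocyclesToExt Y n f) (zero_add n) :=
  (mk₀_comp_extMk f.1 (n + 1) rfl f.2 φ).symm

/-- The morphism of complexes `Hom(P, Y) ⟶ Hom(P', Y)` induced by a morphism of resolutions. -/
noncomputable def linearYonedaMap {P : ProjectiveResolution X} {P' : ProjectiveResolution X'}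
    {g : X' ⟶ X} (φ : Hom P' P g) (Y : ModuleCat.{u} R) :
    P.complex.linearYonedaObj R Y ⟶ P'.complex.linearYonedaObj R Y :=
  (HomologicalComplex.unopFunctor _ _).map
    (((((linearYoneda R (ModuleCat.{u} R)).obj Y).rightOp.mapHomologicalComplex _).map φ.hom).op)

lemma _root_.HomologicalComplex.homologyUnop_hom_naturality {V ι : Type*} [Category* V] [Abelian V]
    {c : ComplexShape ι} {K L : HomologicalComplex Vᵒᵖ c} (ψ : K ⟶ L) (i : ι) :
    HomologicalComplex.homologyMap ((HomologicalComplex.unopFunctor V c).map ψ.op) i ≫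
      (K.homologyUnop i).hom = (L.homologyUnop i).hom ≫ (HomologicalComplex.homologyMap ψ i).unop :=
  congr(Quiver.Hom.unop $(HomologicalComplex.homologyOp_hom_naturality
    ((HomologicalComplex.unopFunctor V c).map ψ.op) i)).symm

lemma isoExt_inv_naturality {P : ProjectiveResolution X} {P' : ProjectiveResolution X'}
    {g : X' ⟶ X} (φ : Hom P' P g) (Y : ModuleCat.{u} R) (n : ℕ) :
    (P.isoExt (R := R) n Y).inv ≫ ((Ext R (ModuleCat.{u} R) n).map g.op).app Y =
      HomologicalComplex.homologyMap (linearYonedaMap φ Y) n ≫ (P'.isoExt (R := R) n Y).inv := by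
  let F := ((linearYoneda R (ModuleCat.{u} R)).obj Y).rightOp
  have h1 := congr(Quiver.Hom.unop $(isoLeftDerivedObj_hom_naturality g P' P φ.hom
    (φ.hom_f_zero_comp_π_f_zero.trans (by rw [ChainComplex.single₀_map_f_zero]; rfl)) F n))
  have h2 := HomologicalComplex.homologyUnop_hom_naturality
    ((F.mapHomologicalComplex (ComplexShape.down ℕ)).map φ.hom) n
  have key : (HomologicalComplex.homologyUnop
      ((F.mapHomologicalComplex (ComplexShape.down ℕ)).obj P.complex) n).hom ≫
        (P.isoLeftDerivedObj F n).hom.unop ≫ ((F.leftDerived n).map g).unop =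
      HomologicalComplex.homologyMap (linearYonedaMap φ Y) n ≫
        (HomologicalComplex.homologyUnop
          ((F.mapHomologicalComplex (ComplexShape.down ℕ)).obj P'.complex) n).hom ≫
          (P'.isoLeftDerivedObj F n).hom.unop :=
    (congrArg (_ ≫ ·) h1).trans ((Category.assoc _ _ _).symm.trans
      ((congrArg (· ≫ _) h2.symm).trans (Category.assoc _ _ _)))
  exact (Category.assoc _ _ _).trans key

lemma cocyclesToLeftDerived_naturality {P : ProjectiveResolution X} {P' : ProjectiveResolution X'}
    {g : X' ⟶ X} (φ : Hom P' P g) (Y : ModuleCat.{u} R) (n : ℕ) (f : P.cocycles Y n) :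
    P'.cocyclesToLeftDerived Y n (cocyclesMap φ Y n f) =
      ((Ext R (ModuleCat.{u} R) n).map g.op).app Y (P.cocyclesToLeftDerived Y n f) := by
  have h : P'.cocyclesToCycles Y n (cocyclesMap φ Y n f) =
      HomologicalComplex.cyclesMap (linearYonedaMap φ Y) n (P.cocyclesToCycles Y n f) := by
    apply P'.iCycles_injective Y n
    refine (congr($(P'.cocyclesToCycles_i Y n) (cocyclesMap φ Y n f))).trans ?_
    refine Eq.trans ?_ congr($(HomologicalComplex.cyclesMap_i (linearYonedaMap φ Y) n)
      (P.cocyclesToCycles Y n f)).symm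
    have := congr($(P.cocyclesToCycles_i Y n) f)
    exact congr((linearYonedaMap φ Y).f n $this).symm
  simp only [cocyclesToLeftDerived, ConcreteCategory.comp_apply]
  rw [h]
  have h2 := congr($(isoExt_inv_naturality φ Y n)
    ((P.complex.linearYonedaObj R Y).homologyπ n (P.cocyclesToCycles Y n f)))
  refine Eq.trans ?_ h2.symm
  refine congr((P'.isoExt n Y).inv $(?_))
  exact congr($(HomologicalComplex.homologyπ_naturality (linearYonedaMap φ Y) n)
    (P.cocyclesToCycles Y n f)).symm

/-- The comparison between `Abelian.Ext` and the derived functors of `Hom(-, Y)`. -/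
lemma exists_ext_equiv_leftDerived (P : ProjectiveResolution X) (Y : ModuleCat.{u} R) (n : ℕ) :
    ∃ e : Abelian.Ext X Y (n + 1) ≃ₗ[R] ((Ext R (ModuleCat.{u} R) (n + 1)).obj (op X)).obj Y,
      ∀ f, e (P.cocyclesToExt Y (n + 1) f) = P.cocyclesToLeftDerived Y (n + 1) f := by
  have hker : LinearMap.ker (P.cocyclesToExt Y (n + 1)) =
      LinearMap.ker (P.cocyclesToLeftDerived Y (n + 1)).hom := by
    ext f
    exact (P.cocyclesToExt_eq_zero_iff Y n f).trans (P.cocyclesToLeftDerived_eq_zero_iff Y n f).symm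
  let e₁ := (P.cocyclesToExt Y (n + 1)).quotKerEquivOfSurjective (P.cocyclesToExt_surjective Y _)
  let e₂ := (P.cocyclesToLeftDerived Y (n + 1)).hom.quotKerEquivOfSurjective
    (P.cocyclesToLeftDerived_surjective Y _)
  refine ⟨e₁.symm ≪≫ₗ Submodule.quotEquivOfEq _ _ hker ≪≫ₗ e₂, fun f ↦ ?_⟩
  have : e₁.symm (P.cocyclesToExt Y (n + 1) f) = Submodule.Quotient.mk f :=
    e₁.symm_apply_eq.2 rfl
  simp only [LinearEquiv.trans_apply, this]
  rfl

/-- `Abelian.Ext X Y (n + 1)` agrees with the derived functors of `Hom(-, Y)`. -/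
noncomputable def _root_.ModuleCat.extEquivLeftDerived (X Y : ModuleCat.{u} R) (n : ℕ) :
    Abelian.Ext X Y (n + 1) ≃ₗ[R] ((Ext R (ModuleCat.{u} R) (n + 1)).obj (op X)).obj Y :=
  ((projectiveResolution X).exists_ext_equiv_leftDerived Y n).choose

lemma _root_.ModuleCat.extEquivLeftDerived_naturality (Y : ModuleCat.{u} R) (n : ℕ)
    (g : X' ⟶ X) (α : Abelian.Ext X Y (n + 1)) :
    ModuleCat.extEquivLeftDerived X' Y n ((Abelian.Ext.mk₀ g).comp α (zero_add _)) =
      ((Ext R (ModuleCat.{u} R) (n + 1)).map g.op).app Y (ModuleCat.extEquivLeftDerived X Y n α) := by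
  let φ : Hom (projectiveResolution X') (projectiveResolution X) g :=
    ⟨lift g _ _, by
      rw [ChainComplex.single₀_map_f_zero]; exact lift_commutes_zero g _ _⟩
  obtain ⟨f, rfl⟩ := cocyclesToExt_surjective (projectiveResolution X) Y (n + 1) α
  have h := fun X ↦ ((projectiveResolution X).exists_ext_equiv_leftDerived Y n).choose_spec
  rw [← cocyclesToExt_naturality φ]
  exact (h X' _).trans ((cocyclesToLeftDerived_naturality φ Y (n + 1) f).trans
    congr((((Ext R (ModuleCat.{u} R) (n + 1)).map g.op).app Y) $((h X f).symm)))

end CategoryTheory.ProjectiveResolution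

namespace ExtColimit

open Abelian

variable {R : Type u} [CommRing R] (I : Ideal R)

/-- The quotient `R ⧸ I ^ n` as an object of the category of modules. -/
noncomputable abbrev quotPow (n : ℕ) : ModuleCat.{u} R := ModuleCat.of R (R ⧸ I ^ n)

/-- The projection `R ⧸ I ^ n ⟶ R ⧸ I ^ m` for `m ≤ n`. -/
noncomputable def quotPowMap {m n : ℕ} (h : m ≤ n) : quotPow I n ⟶ quotPow I m :=
  (localCohomology.ringModIdeals (localCohomology.idealPowersDiagram I)).map (homOfLE h).op

lemma quotPowMap_refl (n : ℕ) : quotPowMap I (le_refl n) = 𝟙 _ :=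
  (localCohomology.ringModIdeals (localCohomology.idealPowersDiagram I)).map_id (op n)

lemma quotPowMap_comp {k m n : ℕ} (h : k ≤ m) (h' : m ≤ n) :
    quotPowMap I h' ≫ quotPowMap I h = quotPowMap I (h.trans h') :=
  ((localCohomology.ringModIdeals (localCohomology.idealPowersDiagram I)).map_comp
    (homOfLE h').op (homOfLE h).op).symm

/-- The transition maps of the direct system `Ext (R ⧸ I ^ n) M i`. -/
noncomputable def transition (i : ℕ) (M : ModuleCat.{u} R) (m n : ℕ) (h : m ≤ n) :
    Ext (quotPow I m) M i →ₗ[R] Ext (quotPow I n) M i :=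
  (Ext.mk₀ (quotPowMap I h)).precompOfLinear R M (zero_add i)

lemma transition_apply (i : ℕ) (M : ModuleCat.{u} R) (m n : ℕ) (h : m ≤ n)
    (x : Ext (quotPow I m) M i) :
    transition I i M m n h x = (Ext.mk₀ (quotPowMap I h)).comp x (zero_add i) := rfl

instance (i : ℕ) (M : ModuleCat.{u} R) :
    DirectedSystem (fun n ↦ Ext (quotPow I n) M i) (fun m n h ↦ transition I i M m n h) where
  map_self n x := by rw [transition_apply, quotPowMap_refl, Ext.mk₀_id_comp]
  map_map k j i' h h' x := by
    rw [transition_apply, transition_apply, transition_apply, Ext.mk₀_comp_mk₀_assoc,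
      quotPowMap_comp]

end ExtColimit

open Abelian

/-- The direct limit of the modules `Ext (R ⧸ I ^ n) M i`. -/
abbrev ExtColimit {R : Type u} [CommRing R] (I : Ideal R) (i : ℕ) (M : ModuleCat.{u} R) : Type u :=
  Module.DirectLimit (fun n : ℕ ↦ Ext (ExtColimit.quotPow I n) M i) (ExtColimit.transition I i M)

namespace ExtColimit

variable {R : Type u} [CommRing R] (I : Ideal R)

/-- The structure maps of `ExtColimit`. -/
noncomputable abbrev of (i : ℕ) (M : ModuleCat.{u} R) (n : ℕ) :
    Ext (quotPow I n) M i →ₗ[R] ExtColimit I i M :=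
  Module.DirectLimit.of R ℕ _ (transition I i M) n

/-- Composition with an element of `Ext`. -/
noncomputable def postcomp {M N : ModuleCat.{u} R} {a b c : ℕ} (β : Ext M N b) (h : a + b = c) :
    ExtColimit I a M →ₗ[R] ExtColimit I c N :=
  Module.DirectLimit.map (fun _ ↦ β.postcompOfLinear R _ h) fun i j hij ↦ by
    ext x
    exact Ext.comp_assoc _ _ _ (zero_add a) h (by lia)

lemma postcomp_of {M N : ModuleCat.{u} R} {a b c : ℕ} (β : Ext M N b) (h : a + b = c) (n : ℕ)
    (x : Ext (quotPow I n) M a) :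
    postcomp I β h (of I a M n x) = of I c N n (x.comp β h) :=
  Module.DirectLimit.map_apply_of _ _ _

lemma exists_of {i : ℕ} {M : ModuleCat.{u} R} (z : ExtColimit I i M) :
    ∃ n x, of I i M n x = z := Module.DirectLimit.exists_of z

lemma of_eq_zero {i : ℕ} {M : ModuleCat.{u} R} {n : ℕ} {x : Ext (quotPow I n) M i}
    (h : of I i M n x = 0) :
    ∃ m, ∃ hm : n ≤ m, (Ext.mk₀ (quotPowMap I hm)).comp x (zero_add i) = 0 :=
  Module.DirectLimit.of.zero_exact h

lemma of_comp {i : ℕ} {M : ModuleCat.{u} R} {n m : ℕ} (h : n ≤ m) (x : Ext (quotPow I n) M i) :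
    of I i M m ((Ext.mk₀ (quotPowMap I h)).comp x (zero_add i)) = of I i M n x :=
  Module.DirectLimit.of_f

/-- The connecting homomorphism. -/
noncomputable def connecting {S : ShortComplex (ModuleCat.{u} R)} (hS : S.ShortExact) (i : ℕ) :
    ExtColimit I i S.X₃ →ₗ[R] ExtColimit I (i + 1) S.X₁ :=
  postcomp I hS.extClass rfl

/-- Functoriality of `ExtColimit` in the module. -/
noncomputable def map {M N : ModuleCat.{u} R} (f : M ⟶ N) (i : ℕ) :
    ExtColimit I i M →ₗ[R] ExtColimit I i N :=
  postcomp I (Ext.mk₀ f) (add_zero i)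

lemma map_of {M N : ModuleCat.{u} R} (f : M ⟶ N) (i n : ℕ) (x : Ext (quotPow I n) M i) :
    map I f i (of I i M n x) = of I i N n (x.comp (Ext.mk₀ f) (add_zero i)) :=
  postcomp_of I _ _ n x

lemma connecting_of {S : ShortComplex (ModuleCat.{u} R)} (hS : S.ShortExact) (i n : ℕ)
    (x : Ext (quotPow I n) S.X₃ i) :
    connecting I hS i (of I i S.X₃ n x) = of I (i + 1) S.X₁ n (x.comp hS.extClass rfl) :=
  postcomp_of I _ _ n x

lemma map_map {M N P : ModuleCat.{u} R} (f : M ⟶ N) (g : N ⟶ P) (i : ℕ) (z : ExtColimit I i M) :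
    map I g i (map I f i z) = map I (f ≫ g) i z := by
  obtain ⟨n, x, rfl⟩ := exists_of I z
  rw [map_of, map_of, map_of, Ext.comp_assoc_of_third_deg_zero, Ext.mk₀_comp_mk₀]

lemma map_smul_id (M : ModuleCat.{u} R) (r : R) (i : ℕ) (z : ExtColimit I i M) :
    map I (r • 𝟙 M) i z = r • z := by
  obtain ⟨n, x, rfl⟩ := exists_of I z
  rw [map_of, ← Ext.smul_eq_comp_mk₀, map_smul]

lemma map_zero' (M N : ModuleCat.{u} R) (i : ℕ) (z : ExtColimit I i M) :
    map I (0 : M ⟶ N) i z = 0 := by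
  obtain ⟨n, x, rfl⟩ := exists_of I z
  rw [map_of, Ext.mk₀_zero, Ext.comp_zero, map_zero]

section Exact

variable {S : ShortComplex (ModuleCat.{u} R)} (hS : S.ShortExact) (i : ℕ)

include hS in
lemma exact₂ : Function.Exact (map I S.f i) (map I S.g i) := by
  refine fun z ↦ ⟨fun h ↦ ?_, ?_⟩
  · obtain ⟨n, x, rfl⟩ := exists_of I z
    rw [map_of] at h
    obtain ⟨m, hm, h⟩ := of_eq_zero I h
    rw [← Ext.comp_assoc_of_third_deg_zero] at h
    obtain ⟨y, hy⟩ := Ext.covariant_sequence_exact₂ _ hS _ h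
    exact ⟨of I i _ m y, by rw [map_of, hy, of_comp]⟩
  · rintro ⟨y, rfl⟩
    rw [map_map, S.zero, map_zero']

lemma exact₃ : Function.Exact (map I S.g i) (connecting I hS i) := by
  refine fun z ↦ ⟨fun h ↦ ?_, ?_⟩
  · obtain ⟨n, x, rfl⟩ := exists_of I z
    rw [connecting_of] at h
    obtain ⟨m, hm, h⟩ := of_eq_zero I h
    rw [← Ext.comp_assoc _ _ _ (zero_add i) rfl (by lia)] at h
    obtain ⟨y, hy⟩ := Ext.covariant_sequence_exact₃ _ hS _ rfl h
    exact ⟨of I i _ m y, by rw [map_of, hy, of_comp]⟩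
  · rintro ⟨y, rfl⟩
    obtain ⟨n, x, rfl⟩ := exists_of I y
    rw [map_of, connecting_of, Ext.comp_assoc_of_second_deg_zero, hS.comp_extClass, Ext.comp_zero,
      map_zero]

lemma exact₁ : Function.Exact (connecting I hS i) (map I S.f (i + 1)) := by
  refine fun z ↦ ⟨fun h ↦ ?_, ?_⟩
  · obtain ⟨n, x, rfl⟩ := exists_of I z
    rw [map_of] at h
    obtain ⟨m, hm, h⟩ := of_eq_zero I h
    rw [← Ext.comp_assoc_of_third_deg_zero] at h
    obtain ⟨y, hy⟩ := Ext.covariant_sequence_exact₁ _ hS _ h rfl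
    exact ⟨of I i _ m y, by rw [connecting_of, hy, of_comp]⟩
  · rintro ⟨y, rfl⟩
    obtain ⟨n, x, rfl⟩ := exists_of I y
    rw [connecting_of, map_of, Ext.comp_assoc_of_third_deg_zero, hS.extClass_comp, Ext.comp_zero,
      map_zero]

end Exact

lemma exists_pow_smul_eq_zero {i : ℕ} {M : ModuleCat.{u} R} (z : ExtColimit I i M) :
    ∃ n : ℕ, ∀ r ∈ I ^ n, r • z = 0 := by
  obtain ⟨n, x, rfl⟩ := exists_of I z
  refine ⟨n, fun r hr ↦ ?_⟩
  have h0 : r • 𝟙 (quotPow I n) = 0 := by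
    refine ModuleCat.hom_ext (LinearMap.ext fun y ↦ ?_)
    obtain ⟨y, rfl⟩ := Submodule.Quotient.mk_surjective _ y
    exact (Submodule.Quotient.mk_eq_zero _).2 (Ideal.mul_mem_right _ _ hr)
  have : r • x = 0 := by
    conv_lhs => rw [← Ext.mk₀_id_comp x, ← Ext.smul_comp, ← Ext.mk₀_smul, h0, Ext.mk₀_zero,
      Ext.zero_comp]
  rw [← map_smul, this, map_zero]

lemma subsingleton_of_injective (i : ℕ) (M : ModuleCat.{u} R) [Injective M] :
    Subsingleton (ExtColimit I (i + 1) M) := by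
  refine subsingleton_of_forall_eq 0 fun z ↦ ?_
  obtain ⟨n, x, rfl⟩ := exists_of I z
  rw [x.eq_zero_of_injective, map_zero]

section Zero

/-- Evaluation at `1`. -/
noncomputable def evalOne (M : ModuleCat.{u} R) (n : ℕ) : Ext (quotPow I n) M 0 →ₗ[R] M :=
  (LinearMap.applyₗ (Submodule.Quotient.mk (1 : R) : R ⧸ I ^ n)) ∘ₗ
    (ModuleCat.homLinearEquiv (S := R) (M := quotPow I n) (N := M)).toLinearMap ∘ₗ
      (Ext.linearEquiv₀ (R := R)).toLinearMap

lemma evalOne_mk₀ (M : ModuleCat.{u} R) (n : ℕ) (f : quotPow I n ⟶ M) :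
    evalOne I M n (Ext.mk₀ f) = f.hom (Submodule.Quotient.mk 1) := by
  have : Ext.linearEquiv₀ (R := R) (Ext.mk₀ f) = f := by
    rw [← Ext.linearEquiv₀_symm_apply (R := R), LinearEquiv.apply_symm_apply]
  exact congr(ModuleCat.Hom.hom $this (Submodule.Quotient.mk 1))

lemma exists_mk₀ {M N : ModuleCat.{u} R} (x : Ext M N 0) : ∃ f, x = Ext.mk₀ f := by
  obtain ⟨f, rfl⟩ := (Ext.mk₀_bijective M N).2 x
  exact ⟨f, rfl⟩

/-- The comparison between degree zero and the torsion submodule. -/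
noncomputable def eval (M : ModuleCat.{u} R) : ExtColimit I 0 M →ₗ[R] M :=
  Module.DirectLimit.lift R ℕ _ _ (evalOne I M) fun m n h x ↦ by
    obtain ⟨f, rfl⟩ := exists_mk₀ x
    rw [transition_apply, Ext.mk₀_comp_mk₀, evalOne_mk₀, evalOne_mk₀]
    rfl

lemma eval_of_mk₀ (M : ModuleCat.{u} R) (n : ℕ) (f : quotPow I n ⟶ M) :
    eval I M (of I 0 M n (Ext.mk₀ f)) = f.hom (Submodule.Quotient.mk 1) :=
  (Module.DirectLimit.lift_of _ _ _).trans (evalOne_mk₀ I M n f)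

lemma eval_injective (M : ModuleCat.{u} R) : Function.Injective (eval I M) := by
  rw [injective_iff_map_eq_zero]
  intro z hz
  obtain ⟨n, x, rfl⟩ := exists_of I z
  obtain ⟨f, rfl⟩ := exists_mk₀ x
  rw [eval_of_mk₀] at hz
  have : f = 0 := by
    refine ModuleCat.hom_ext (LinearMap.ext fun y ↦ ?_)
    obtain ⟨y, rfl⟩ := Submodule.Quotient.mk_surjective _ y
    rw [show (Submodule.Quotient.mk y : R ⧸ I ^ n) = y • Submodule.Quotient.mk 1 by
      rw [← Submodule.Quotient.mk_smul, smul_eq_mul, mul_one], map_smul, hz, smul_zero]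
    rfl
  rw [this, Ext.mk₀_zero, map_zero]

lemma eval_map {M N : ModuleCat.{u} R} (f : M ⟶ N) (z : ExtColimit I 0 M) :
    eval I N (map I f 0 z) = f.hom (eval I M z) := by
  obtain ⟨n, x, rfl⟩ := exists_of I z
  obtain ⟨g, rfl⟩ := exists_mk₀ x
  rw [map_of, Ext.mk₀_comp_mk₀, eval_of_mk₀, eval_of_mk₀]
  rfl

lemma exists_eval_eq {M : ModuleCat.{u} R} {x : M} {n : ℕ} (h : ∀ r ∈ I ^ n, r • x = 0) :
    ∃ z, eval I M z = x := by
  let f : quotPow I n ⟶ M :=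
    ModuleCat.ofHom (Submodule.liftQ _ (LinearMap.toSpanSingleton R M x) fun r hr ↦ h r hr)
  refine ⟨of I 0 M n (Ext.mk₀ f), ?_⟩
  rw [eval_of_mk₀]
  exact one_smul R x

end Zero

end ExtColimit

namespace ExtColimit

open Abelian Limits

variable {R : Type u} [CommRing R] (I : Ideal R)

/-- The cocone comparing the diagram defining local cohomology to `ExtColimit`. -/
noncomputable def diagramCocone (i : ℕ) (M : ModuleCat.{u} R) :
    Cocone (localCohomology.diagram (localCohomology.idealPowersDiagram I) (i + 1) ⋙
      (evaluation _ _).obj M) where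
  pt := ModuleCat.of R (ExtColimit I (i + 1) M)
  ι :=
    { app n := ModuleCat.ofHom ((of I (i + 1) M n.unop.unop) ∘ₗ
        (ModuleCat.extEquivLeftDerived (quotPow I n.unop.unop) M i).symm.toLinearMap)
      naturality m n f := by
        refine ModuleCat.hom_ext (LinearMap.ext fun y ↦ ?_)
        obtain ⟨x, rfl⟩ := (ModuleCat.extEquivLeftDerived (quotPow I m.unop.unop) M i).surjective y
        have h := ModuleCat.extEquivLeftDerived_naturality M i
          (quotPowMap I (leOfHom f.unop.unop)) x
        have h1 : ((localCohomology.diagram (localCohomology.idealPowersDiagram I) (i + 1) ⋙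
            (evaluation _ _).obj M).map f) (ModuleCat.extEquivLeftDerived _ M i x) =
            ModuleCat.extEquivLeftDerived (quotPow I n.unop.unop) M i
              ((Ext.mk₀ (quotPowMap I (leOfHom f.unop.unop))).comp x (zero_add _)) := h.symm
        refine (congrArg (fun z ↦ of I (i + 1) M n.unop.unop
          ((ModuleCat.extEquivLeftDerived (quotPow I n.unop.unop) M i).symm z)) h1).trans ?_
        refine (congrArg (of I (i + 1) M n.unop.unop) (LinearEquiv.symm_apply_apply _ _)).trans ?_
        refine (of_comp I _ x).trans ?_
        exact (congrArg (of I (i + 1) M m.unop.unop) (LinearEquiv.symm_apply_apply _ _)).symm }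

lemma exists_surjective_of_localCohomology (i : ℕ) (M : ModuleCat.{u} R) :
    ∃ f : (localCohomology I (i + 1)).obj M →ₗ[R] ExtColimit I (i + 1) M,
      Function.Surjective f := by
  have hc := isColimitOfPreserves ((evaluation _ _).obj M) (colimit.isColimit
    (localCohomology.diagram (localCohomology.idealPowersDiagram I) (i + 1)))
  refine ⟨(hc.desc (diagramCocone I i M)).hom, fun z ↦ ?_⟩
  obtain ⟨n, x, rfl⟩ := exists_of I z
  have h := hc.fac (diagramCocone I i M) (op (op n))
  refine ⟨_, (congr(ModuleCat.Hom.hom $h (ModuleCat.extEquivLeftDerived (quotPow I n) M i x))).trans ?_⟩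
  exact (congrArg (of I (i + 1) M n) (LinearEquiv.symm_apply_apply _ _))

end ExtColimit

/-- The direct limit of the modules `Ext (R ⧸ I ^ n) M i`, for an unbundled module `M`. -/
abbrev LocalCohomologyModule {R : Type u} [CommRing R] (I : Ideal R) (i : ℕ)
    (M : Type u) [AddCommGroup M] [Module R M] : Type u :=
  ExtColimit I i (ModuleCat.of R M)

namespace LocalCohomologyModule

variable {R : Type u} [CommRing R] (I : Ideal R) {M N P : Type u} [AddCommGroup M] [Module R M]
  [AddCommGroup N] [Module R N] [AddCommGroup P] [Module R P]

/-- Functoriality of local cohomology in the module. -/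
noncomputable def map (f : M →ₗ[R] N) (i : ℕ) :
    LocalCohomologyModule I i M →ₗ[R] LocalCohomologyModule I i N :=
  ExtColimit.map I (ModuleCat.ofHom f) i

lemma map_comp_apply (f : M →ₗ[R] N) (g : N →ₗ[R] P) (i : ℕ) (z : LocalCohomologyModule I i M) :
    map I (g ∘ₗ f) i z = map I g i (map I f i z) :=
  (ExtColimit.map_map I (ModuleCat.ofHom f) (ModuleCat.ofHom g) i z).symm

lemma map_lsmul (r : R) (i : ℕ) (z : LocalCohomologyModule I i M) :
    map I (LinearMap.lsmul R M r) i z = r • z :=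
  ExtColimit.map_smul_id I (ModuleCat.of R M) r i z

lemma map_id_apply (i : ℕ) (z : LocalCohomologyModule I i M) : map I LinearMap.id i z = z := by
  have h : (LinearMap.id : M →ₗ[R] M) = LinearMap.lsmul R M 1 := by ext; simp
  rw [h, map_lsmul, one_smul]

lemma map_zero_apply (i : ℕ) (z : LocalCohomologyModule I i M) :
    map I (0 : M →ₗ[R] N) i z = 0 :=
  ExtColimit.map_zero' I _ _ i z

/-- Local cohomology of isomorphic modules. -/
noncomputable def congr (e : M ≃ₗ[R] N) (i : ℕ) :
    LocalCohomologyModule I i M ≃ₗ[R] LocalCohomologyModule I i N :=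
  LinearEquiv.ofLinearMap (map I e.toLinearMap i) (map I e.symm.toLinearMap i)
    (LinearMap.ext fun z ↦ by
      rw [LinearMap.comp_apply, ← map_comp_apply, e.comp_symm, map_id_apply, LinearMap.id_apply])
    (LinearMap.ext fun z ↦ by
      rw [LinearMap.comp_apply, ← map_comp_apply, e.symm_comp, map_id_apply, LinearMap.id_apply])

lemma subsingleton_of_subsingleton [Subsingleton M] (i : ℕ) :
    Subsingleton (LocalCohomologyModule I i M) := by
  refine subsingleton_of_forall_eq 0 fun z ↦ ?_
  rw [← map_id_apply I i z, Subsingleton.elim (LinearMap.id : M →ₗ[R] M) 0, map_zero_apply]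

lemma smul_eq_zero_of_mem_annihilator {r : R} (hr : r ∈ Module.annihilator R M) (i : ℕ)
    (z : LocalCohomologyModule I i M) : r • z = 0 := by
  rw [← map_lsmul]
  have : LinearMap.lsmul R M r = 0 := LinearMap.ext (Module.mem_annihilator.1 hr)
  rw [this, map_zero_apply]

lemma exists_pow_smul_eq_zero (i : ℕ) (z : LocalCohomologyModule I i M) :
    ∃ n : ℕ, ∀ r ∈ I ^ n, r • z = 0 := ExtColimit.exists_pow_smul_eq_zero I z

lemma subsingleton_of_injective [Module.Injective R M] (i : ℕ) :
    Subsingleton (LocalCohomologyModule I (i + 1) M) :=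
  have : Injective (ModuleCat.of R M) := Module.injective_object_of_injective_module R M
  ExtColimit.subsingleton_of_injective I i _

section Exact

variable {f : M →ₗ[R] N} {g : N →ₗ[R] P} (hf : Function.Injective f) (hg : Function.Surjective g)
  (hfg : Function.Exact f g) (i : ℕ)

include hf hg in
lemma shortExact : (ShortComplex.mk (ModuleCat.ofHom f) (ModuleCat.ofHom g)
    (ModuleCat.hom_ext hfg.linearMap_comp_eq_zero)).ShortExact where
  exact := (ShortComplex.ShortExact.moduleCat_exact_iff_function_exact _).2 hfg
  mono_f := (ModuleCat.mono_iff_injective _).2 hf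
  epi_g := (ModuleCat.epi_iff_surjective _).2 hg

/-- The connecting homomorphism. -/
noncomputable def connecting :
    LocalCohomologyModule I i P →ₗ[R] LocalCohomologyModule I (i + 1) M :=
  ExtColimit.connecting I (shortExact hf hg hfg) i

include hf hg hfg in
lemma exact₂ : Function.Exact (map I f i) (map I g i) :=
  ExtColimit.exact₂ I (shortExact hf hg hfg) i

lemma exact₃ : Function.Exact (map I g i) (connecting I hf hg hfg i) :=
  ExtColimit.exact₃ I (shortExact hf hg hfg) i

lemma exact₁ : Function.Exact (connecting I hf hg hfg i) (map I f (i + 1)) :=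
  ExtColimit.exact₁ I (shortExact hf hg hfg) i

end Exact

/-- The comparison between degree zero and the torsion submodule. -/
noncomputable def eval (M : Type u) [AddCommGroup M] [Module R M] :
    LocalCohomologyModule I 0 M →ₗ[R] M :=
  ExtColimit.eval I (ModuleCat.of R M)

lemma eval_injective : Function.Injective (eval I M) := ExtColimit.eval_injective I _

lemma eval_map (f : M →ₗ[R] N) (z : LocalCohomologyModule I 0 M) :
    eval I N (map I f 0 z) = f (eval I M z) :=
  ExtColimit.eval_map I _ z

lemma exists_eval_eq {x : M} {n : ℕ} (h : ∀ r ∈ I ^ n, r • x = 0) : ∃ z, eval I M z = x :=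
  ExtColimit.exists_eval_eq I (M := ModuleCat.of R M) h

lemma exists_pow_smul_eval_eq_zero (z : LocalCohomologyModule I 0 M) :
    ∃ n : ℕ, ∀ r ∈ I ^ n, r • eval I M z = 0 := by
  obtain ⟨n, hn⟩ := exists_pow_smul_eq_zero I 0 z
  exact ⟨n, fun r hr ↦ by rw [← map_smul, hn r hr, map_zero]⟩

lemma exists_surjective_of_localCohomology (i : ℕ) :
    ∃ f : (localCohomology I (i + 1)).obj (ModuleCat.of R M) →ₗ[R]
      LocalCohomologyModule I (i + 1) M, Function.Surjective f :=
  ExtColimit.exists_surjective_of_localCohomology I i _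

end LocalCohomologyModule

namespace Ideal

variable {R : Type*} [CommRing R] (I : Ideal R) (M : Type*) [AddCommGroup M] [Module R M]
  {N : Type*} [AddCommGroup N] [Module R N]

/-- The submodule of elements killed by a power of `I`. -/
def powTorsion : Submodule R M where
  carrier := {x | ∃ n : ℕ, ∀ r ∈ I ^ n, r • x = 0}
  zero_mem' := ⟨0, fun _ _ ↦ smul_zero _⟩
  add_mem' := by
    rintro x y ⟨m, hm⟩ ⟨n, hn⟩
    exact ⟨m + n, fun r hr ↦ by rw [smul_add, hm r (pow_le_pow_right (by lia) hr),
      hn r (pow_le_pow_right (by lia) hr), add_zero]⟩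
  smul_mem' := by
    rintro c x ⟨n, hn⟩
    exact ⟨n, fun r hr ↦ by rw [smul_comm, hn r hr, smul_zero]⟩

variable {M}

variable {I} in
lemma map_mem_powTorsion {x : M} (hx : x ∈ I.powTorsion M) (f : M →ₗ[R] N) :
    f x ∈ I.powTorsion N := by
  obtain ⟨n, hn⟩ := hx
  exact ⟨n, fun r hr ↦ by rw [← map_smul, hn r hr, map_zero]⟩

variable {I} in
lemma mem_powTorsion_of_map {f : M →ₗ[R] N} (hf : Function.Injective f) {x : M}
    (hx : f x ∈ I.powTorsion N) : x ∈ I.powTorsion M := by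
  obtain ⟨n, hn⟩ := hx
  exact ⟨n, fun r hr ↦ hf (by rw [map_smul, hn r hr, map_zero])⟩

lemma powTorsion_powTorsion : I.powTorsion (I.powTorsion M) = ⊤ :=
  eq_top_iff.2 fun x _ ↦ mem_powTorsion_of_map (I.powTorsion M).injective_subtype x.2

lemma exists_pow_smul_eq_zero_of_fg {N : Submodule R M} (hN : N.FG) (h : N ≤ I.powTorsion M) :
    ∃ n : ℕ, ∀ r ∈ I ^ n, ∀ x ∈ N, r • x = 0 := by
  obtain ⟨s, rfl⟩ := hN
  choose! n hn using fun x (hx : x ∈ s) ↦ h (Submodule.subset_span hx)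
  refine ⟨s.sup n, fun r hr x hx ↦ ?_⟩
  have : Submodule.span R (s : Set M) ≤ LinearMap.ker (LinearMap.lsmul R M r) :=
    Submodule.span_le.2 fun y hy ↦ hn y hy r (pow_le_pow_right (Finset.le_sup hy) hr)
  exact this hx

lemma powTorsion_quotient_eq_bot [IsNoetherianRing R] :
    I.powTorsion (M ⧸ I.powTorsion M) = ⊥ := by
  rw [eq_bot_iff]
  intro x hx
  obtain ⟨x, rfl⟩ := Submodule.Quotient.mk_surjective _ x
  obtain ⟨n, hn⟩ := hx
  have hfg : (Submodule.map (LinearMap.toSpanSingleton R M x) (I ^ n)).FG :=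
    Submodule.FG.map _ ((isNoetherianRing_iff_ideal_fg R).1 ‹_› _)
  obtain ⟨k, hk⟩ := I.exists_pow_smul_eq_zero_of_fg hfg (by
    rintro _ ⟨r, hr, rfl⟩
    exact (Submodule.Quotient.mk_eq_zero _).1 (hn r hr))
  refine (Submodule.Quotient.mk_eq_zero _).2 ⟨k + n, fun r hr ↦ ?_⟩
  rw [pow_add] at hr
  refine Submodule.mul_induction_on hr (fun a ha b hb ↦ ?_) fun a b ha hb ↦ ?_
  · rw [mul_smul]
    exact hk a ha _ ⟨b, hb, rfl⟩
  · rw [add_smul, ha, hb, add_zero]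

end Ideal

section Injective

variable {R : Type u} [CommRing R]

lemma Module.exists_injective_linearMap (M : Type u) [AddCommGroup M] [Module R M] :
    ∃ (E : Type u) (_ : AddCommGroup E) (_ : Module R E) (f : M →ₗ[R] E),
      Module.Injective R E ∧ Function.Injective f :=
  ⟨(Injective.under (ModuleCat.of R M) : ModuleCat.{u} R), inferInstance, inferInstance,
    (Injective.ι (ModuleCat.of R M)).hom,
    have : CategoryTheory.Injective (ModuleCat.of R (Injective.under (ModuleCat.of R M) : ModuleCat.{u} R)) :=
      inferInstanceAs (CategoryTheory.Injective (Injective.under (ModuleCat.of R M)))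
    Module.injective_module_of_injective_object _ _,
    (ModuleCat.mono_iff_injective _).1 inferInstance⟩

instance Ideal.injective_powTorsion [IsNoetherianRing R] (I : Ideal R) (E : Type u)
    [AddCommGroup E] [Module R E] [Module.Injective R E] :
    Module.Injective R (I.powTorsion E) := by
  refine Module.Baer.injective fun J g ↦ ?_
  have hfg : (LinearMap.range g).FG :=
    (LinearMap.range_eq_map g) ▸ Module.Finite.fg_top.map g
  obtain ⟨n, hn⟩ := I.exists_pow_smul_eq_zero_of_fg hfg (by rw [powTorsion_powTorsion]; exact le_top)
  obtain ⟨k, hk⟩ := I.exists_pow_inf_eq_pow_smul J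
  have hker : Submodule.comap J.subtype (I ^ (n + k)) ≤ LinearMap.ker g := by
    rintro ⟨x, hxJ⟩ hx
    have h1 : x ∈ I ^ n • (I ^ k • ⊤ ⊓ J) := by
      have := hk (n + k) (by lia)
      rw [Nat.add_sub_cancel] at this
      rw [← this]
      exact ⟨by simpa using hx, hxJ⟩
    have h2 : x ∈ Submodule.map J.subtype (LinearMap.ker g) := by
      refine Submodule.smul_induction_on h1 (fun a ha b hb ↦ ?_) fun a b ha hb ↦ add_mem ha hb
      exact ⟨a • ⟨b, hb.2⟩, by rw [SetLike.mem_coe, LinearMap.mem_ker, map_smul, hn a ha _ ⟨_, rfl⟩],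
        rfl⟩
    obtain ⟨y, hy, hyx⟩ := h2
    have : y = ⟨x, hxJ⟩ := Subtype.ext hyx
    exact this ▸ hy
  let j : (J ⧸ Submodule.comap J.subtype (I ^ (n + k))) →ₗ[R] R ⧸ I ^ (n + k) :=
    Submodule.mapQ _ _ J.subtype le_rfl
  have hj : Function.Injective j := by
    rw [← LinearMap.ker_eq_bot, Submodule.ker_mapQ]
    simp
  obtain ⟨h, hh⟩ := Module.Injective.out j hj
    ((I.powTorsion E).subtype ∘ₗ Submodule.liftQ _ g hker)
  refine ⟨LinearMap.codRestrict _ (h ∘ₗ Submodule.mkQ _) fun x ↦ ?_, fun x hx ↦ ?_⟩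
  · refine ⟨n + k, fun r hr ↦ ?_⟩
    rw [LinearMap.comp_apply, ← map_smul, ← map_smul]
    exact (congrArg h ((Submodule.Quotient.mk_eq_zero (I ^ (n + k))).2
      (Ideal.mul_mem_right x _ hr))).trans (map_zero h)
  · exact Subtype.ext (hh (Submodule.Quotient.mk ⟨x, hx⟩))

end Injective

namespace LocalCohomologyModule

variable {R : Type u} [CommRing R] (I : Ideal R)

lemma range_eval (M : Type u) [AddCommGroup M] [Module R M] :
    LinearMap.range (eval I M) = I.powTorsion M := by
  ext x
  constructor
  · rintro ⟨z, rfl⟩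
    exact exists_pow_smul_eval_eq_zero I z
  · rintro ⟨n, hn⟩
    exact exists_eval_eq I hn

lemma subsingleton_zero_iff {M : Type u} [AddCommGroup M] [Module R M] :
    Subsingleton (LocalCohomologyModule I 0 M) ↔ I.powTorsion M = ⊥ := by
  rw [← range_eval, LinearMap.range_eq_bot]
  refine ⟨fun h ↦ LinearMap.ext fun z ↦ by rw [Subsingleton.elim z 0, map_zero, map_zero], fun h ↦ ?_⟩
  refine subsingleton_of_forall_eq 0 fun z ↦ eval_injective I ?_
  rw [h]; rfl

lemma map_surjective_zero {M N : Type u} [AddCommGroup M] [Module R M] [AddCommGroup N]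
    [Module R N] {f : M →ₗ[R] N} (hf : Function.Surjective f) (hM : I.powTorsion M = ⊤) :
    Function.Surjective (map I f 0) := fun z ↦ by
  obtain ⟨y, hy⟩ := hf (eval I N z)
  have : y ∈ LinearMap.range (eval I M) := by rw [range_eval, hM]; trivial
  obtain ⟨w, rfl⟩ := this
  exact ⟨w, eval_injective I (by rw [eval_map, hy])⟩

variable [IsNoetherianRing R]

lemma subsingleton_of_powTorsion_eq_top (i : ℕ) (M : Type u) [AddCommGroup M] [Module R M]
    (hM : I.powTorsion M = ⊤) : Subsingleton (LocalCohomologyModule I (i + 1) M) := by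
  induction i generalizing M with
  | zero =>
    obtain ⟨E, _, _, f, _, hf⟩ := Module.exists_injective_linearMap (R := R) M
    let j : M →ₗ[R] I.powTorsion E := f.codRestrict _ fun x ↦
      Ideal.map_mem_powTorsion (hM ▸ Submodule.mem_top) f
    have hj : Function.Injective j := fun x y h ↦ hf congr(($h).1)
    have hex : Function.Exact j (LinearMap.range j).mkQ := LinearMap.exact_map_mkQ_range j
    have hs := subsingleton_of_injective I (M := I.powTorsion E) 0
    refine subsingleton_of_forall_eq 0 fun z ↦ ?_
    obtain ⟨w, rfl⟩ := (exact₁ I hj (Submodule.mkQ_surjective _) hex 0 z).1 (Subsingleton.elim _ _)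
    exact (exact₃ I hj (Submodule.mkQ_surjective _) hex 0 w).2
      (map_surjective_zero I (Submodule.mkQ_surjective _) I.powTorsion_powTorsion w)
  | succ i ih =>
    obtain ⟨E, _, _, f, _, hf⟩ := Module.exists_injective_linearMap (R := R) M
    let j : M →ₗ[R] I.powTorsion E := f.codRestrict _ fun x ↦
      Ideal.map_mem_powTorsion (hM ▸ Submodule.mem_top) f
    have hj : Function.Injective j := fun x y h ↦ hf congr(($h).1)
    have hex : Function.Exact j (LinearMap.range j).mkQ := LinearMap.exact_map_mkQ_range j
    have hs := subsingleton_of_injective I (M := I.powTorsion E) (i + 1)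
    have htop : I.powTorsion (I.powTorsion E ⧸ LinearMap.range j) = ⊤ := by
      refine eq_top_iff.2 fun x _ ↦ ?_
      obtain ⟨x, rfl⟩ := Submodule.mkQ_surjective _ x
      have hx : x ∈ I.powTorsion (I.powTorsion E) := by rw [I.powTorsion_powTorsion]; trivial
      exact Ideal.map_mem_powTorsion hx (LinearMap.range j).mkQ
    have hC := ih _ htop
    refine subsingleton_of_forall_eq 0 fun z ↦ ?_
    obtain ⟨w, rfl⟩ := (exact₁ I hj (Submodule.mkQ_surjective _) hex (i + 1) z).1
      (Subsingleton.elim _ _)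
    rw [Subsingleton.elim w 0, map_zero]

/-- Local cohomology in positive degrees is insensitive to the torsion submodule. -/
noncomputable def quotientPowTorsionEquiv (i : ℕ) (M : Type u) [AddCommGroup M] [Module R M] :
    LocalCohomologyModule I (i + 1) M ≃ₗ[R] LocalCohomologyModule I (i + 1) (M ⧸ I.powTorsion M) :=
  have hex : Function.Exact (I.powTorsion M).subtype (I.powTorsion M).mkQ :=
    LinearMap.exact_subtype_mkQ _
  have h (i) := subsingleton_of_powTorsion_eq_top I i (I.powTorsion M) I.powTorsion_powTorsion
  LinearEquiv.ofBijective (map I (I.powTorsion M).mkQ (i + 1)) <| by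
    refine ⟨(injective_iff_map_eq_zero (map I (I.powTorsion M).mkQ (i + 1))).2 fun z hz ↦ ?_,
      fun z ↦ ?_⟩
    · obtain ⟨w, rfl⟩ := (exact₂ I (Submodule.injective_subtype _) (Submodule.mkQ_surjective _)
        hex (i + 1) z).1 hz
      rw [(h i).elim w 0, map_zero]
    · exact (exact₃ I (Submodule.injective_subtype _) (Submodule.mkQ_surjective _) hex (i + 1) z).1
        ((h (i + 1)).elim _ _)

end LocalCohomologyModule

section Artinian

variable {A : Type*} [CommRing A]

open IsLocalRing in
lemma isArtinian_of_maximalIdeal_le_radical_annihilator [IsLocalRing A] [IsNoetherianRing A]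
    {M : Type*} [AddCommGroup M] [Module A M] [Module.Finite A M]
    (h : maximalIdeal A ≤ (Module.annihilator A M).radical) : IsArtinian A M := by
  let B := A ⧸ Module.annihilator A M
  let : Module B M := Module.quotientAnnihilator
  have : IsScalarTower A B M := Module.IsTorsionBySet.isScalarTower _
  have hB : Ring.KrullDimLE 0 B := Ring.KrullDimLE.mk₀ fun P hP ↦ by
    have hP' : (P.comap (Ideal.Quotient.mk (Module.annihilator A M))).IsPrime := inferInstance
    have h1 : maximalIdeal A ≤ P.comap (Ideal.Quotient.mk (Module.annihilator A M)) :=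
      h.trans (hP'.radical_le_iff.2 fun a ha ↦ by
        rw [Ideal.mem_comap, Ideal.Quotient.eq_zero_iff_mem.2 ha]
        exact zero_mem _)
    have h2 := (maximalIdeal.isMaximal A).eq_of_le hP'.ne_top h1
    have h3 : (P.comap (Ideal.Quotient.mk (Module.annihilator A M))).IsMaximal :=
      h2 ▸ maximalIdeal.isMaximal A
    rw [← Ideal.map_comap_of_surjective _ Ideal.Quotient.mk_surjective P]
    refine (Ideal.map_eq_top_or_isMaximal_of_surjective _ Ideal.Quotient.mk_surjective h3).resolve_left
      fun h4 ↦ hP.ne_top ?_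
    rwa [Ideal.map_comap_of_surjective _ Ideal.Quotient.mk_surjective P] at h4
  have : IsArtinianRing B := isArtinianRing_iff_krullDimLE_zero.2 hB
  have : Module.Finite B M := Module.Finite.of_restrictScalars_finite A B M
  have : IsArtinian B M := inferInstance
  exact isArtinian_of_surjective_algebraMap (S := A) (R := B) Ideal.Quotient.mk_surjective

/-- **Melkersson's criterion** for a principal ideal. -/
lemma isArtinian_of_isArtinian_ker_lsmul {H : Type*} [AddCommGroup H] [Module A H] (x : A)
    (hx : ∀ h : H, ∃ n : ℕ, x ^ n • h = 0) [IsArtinian A (LinearMap.ker (LinearMap.lsmul A H x))] :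
    IsArtinian A H := by
  rw [← monotone_stabilizes_iff_artinian]
  intro f
  let N (j : ℕ) : Submodule A H := OrderDual.ofDual (f j)
  have hN : Antitone N := fun i j h ↦ f.monotone h
  let K (j k : ℕ) : Submodule A (LinearMap.ker (LinearMap.lsmul A H x)) :=
    ((N j).map (LinearMap.lsmul A H (x ^ k))).comap (Submodule.subtype _)
  have hK : ∀ {j j' k k' : ℕ}, j ≤ j' → k ≤ k' → K j' k' ≤ K j k := by
    rintro j j' k k' hj hk ⟨z, hz⟩ ⟨y, hy, hyz⟩
    refine ⟨x ^ (k' - k) • y, (N j).smul_mem _ (hN hj hy), ?_⟩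
    have : x ^ k' • y = z := hyz
    change x ^ k • x ^ (k' - k) • y = z
    rw [← this, smul_smul, ← pow_add, Nat.add_sub_cancel' hk]
  obtain ⟨n₀, hn₀⟩ := IsArtinian.monotone_stabilizes
    (⟨fun n ↦ OrderDual.toDual (K n n), fun i j h ↦ hK h h⟩ :
      ℕ →o (Submodule A (LinearMap.ker (LinearMap.lsmul A H x)))ᵒᵈ)
  choose a ha using fun k ↦ IsArtinian.monotone_stabilizes
    (⟨fun n ↦ OrderDual.toDual (K n k), fun i j h ↦ hK h le_rfl⟩ :
      ℕ →o (Submodule A (LinearMap.ker (LinearMap.lsmul A H x)))ᵒᵈ)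
  let J := max n₀ ((Finset.range n₀).sup a)
  have hJ : ∀ j ≥ J, ∀ k, K J k ≤ K j k := by
    intro j hj k
    by_cases hk : k < n₀
    · have hak : a k ≤ J := (Finset.le_sup (Finset.mem_range.2 hk)).trans (le_max_right _ _)
      have h1 : K J k = K j k := (ha k J hak).symm.trans (ha k j (hak.trans hj))
      exact h1.le
    · have h0 : n₀ ≤ J := le_max_left _ _
      calc K J k ≤ K n₀ n₀ := hK h0 (not_lt.1 hk)
        _ = K (max j k) (max j k) := hn₀ (max j k) (by lia)
        _ ≤ K j k := hK (le_max_left _ _) (le_max_right _ _)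
  refine ⟨J, fun j hj ↦ ?_⟩
  refine le_antisymm (α := (Submodule A H)ᵒᵈ) (f.monotone hj) ?_
  have key : ∀ n : ℕ, ∀ y ∈ N J, x ^ n • y = 0 → y ∈ N j := by
    intro n
    induction n with
    | zero =>
      intro y _ h
      rw [pow_zero, one_smul] at h
      exact h ▸ zero_mem _
    | succ n ih =>
      intro y hy h
      have h1 : (⟨x ^ n • y, by rw [LinearMap.mem_ker, LinearMap.lsmul_apply, smul_smul, ← pow_succ', h]⟩ :
          LinearMap.ker (LinearMap.lsmul A H x)) ∈ K j n := hJ j hj n ⟨y, hy, rfl⟩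
      obtain ⟨y', hy', hyy'⟩ := h1
      have h2 : x ^ n • y' = x ^ n • y := hyy'
      have h3 := ih (y - y') (sub_mem hy (hN hj hy')) (by rw [smul_sub, h2, sub_self])
      simpa using add_mem h3 hy'
  intro y hy
  obtain ⟨n, hn⟩ := hx y
  exact key n y hy hn

open IsLocalRing Pointwise

lemma Submodule.exists_fg_sup_maximalIdeal_smul [IsLocalRing A] {H : Type*} [AddCommGroup H]
    [Module A H] [IsArtinian A H] (S : Submodule A H) :
    ∃ F ≤ S, F.FG ∧ S ≤ F ⊔ maximalIdeal A • S := by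
  let V := S ⧸ (maximalIdeal A • ⊤ : Submodule A S)
  have : IsScalarTower A (A ⧸ maximalIdeal A) V := inferInstance
  let : Field (A ⧸ maximalIdeal A) := Ideal.Quotient.field _
  have h1 : IsArtinian (A ⧸ maximalIdeal A) V := isArtinian_of_tower A inferInstance
  have h2 : Module.Finite (A ⧸ maximalIdeal A) V := (IsSemisimpleModule.finite_tfae.out 0 2).2 h1
  have h3 : Module.Finite A V := Module.Finite.trans (A ⧸ maximalIdeal A) V
  classical
  obtain ⟨t, ht⟩ := h3.fg_top
  let g : V → S := Function.surjInv (Submodule.mkQ_surjective (maximalIdeal A • ⊤ : Submodule A S))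
  have hg : ∀ v, (maximalIdeal A • ⊤ : Submodule A S).mkQ (g v) = v := Function.surjInv_eq _
  let F₀ : Submodule A S := Submodule.span A (g '' t)
  have hF₀ : F₀ ⊔ maximalIdeal A • ⊤ = ⊤ := by
    rw [sup_comm, ← Submodule.map_mkQ_eq_top, Submodule.map_span, ← Set.image_comp,
      show _ ∘ g = id from funext hg, Set.image_id, ht]
  refine ⟨F₀.map S.subtype, Submodule.map_subtype_le _ _,
    (Submodule.fg_span (t.finite_toSet.image g)).map _, ?_⟩
  have h4 := congrArg (Submodule.map S.subtype) hF₀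
  rw [Submodule.map_sup, Submodule.map_smul'', Submodule.map_subtype_top] at h4
  exact h4.ge

lemma IsArtinian.exists_finset_prime_forall_fg_sup_smul [IsLocalRing A] [IsNoetherianRing A]
    {H : Type*} [AddCommGroup H] [Module A H] [IsArtinian A H] (S : Submodule A H) :
    ∃ Q : Finset (Ideal A), (∀ p ∈ Q, p.IsPrime ∧ p ≠ maximalIdeal A) ∧
      ∀ x : A, (∀ p ∈ Q, x ∉ p) → ∃ F : Submodule A H, F.FG ∧ S ≤ F ⊔ x • S := by
  classical
  induction S using WellFoundedLT.induction with
  | ind S ih =>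
  by_cases hbot : S = ⊥
  · exact ⟨∅, by simp, fun x _ ↦ ⟨⊥, Submodule.fg_bot, by simp [hbot]⟩⟩
  by_cases hred : ∃ S₁ S₂, S₁ < S ∧ S₂ < S ∧ S ≤ S₁ ⊔ S₂
  · obtain ⟨S₁, S₂, h₁, h₂, h⟩ := hred
    obtain ⟨Q₁, hQ₁, hx₁⟩ := ih S₁ h₁
    obtain ⟨Q₂, hQ₂, hx₂⟩ := ih S₂ h₂
    refine ⟨Q₁ ∪ Q₂, fun p hp ↦ (Finset.mem_union.1 hp).elim (hQ₁ p) (hQ₂ p), fun x hx ↦ ?_⟩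
    obtain ⟨F₁, hF₁, hS₁⟩ := hx₁ x fun p hp ↦ hx p (Finset.mem_union_left _ hp)
    obtain ⟨F₂, hF₂, hS₂⟩ := hx₂ x fun p hp ↦ hx p (Finset.mem_union_right _ hp)
    refine ⟨F₁ ⊔ F₂, hF₁.sup hF₂, h.trans (sup_le (hS₁.trans ?_) (hS₂.trans ?_))⟩
    · exact sup_le_sup le_sup_left (Submodule.map_mono h₁.le)
    · exact sup_le_sup le_sup_right (Submodule.map_mono h₂.le)
  have hirr : ∀ S₁ S₂ : Submodule A H, S₁ ≤ S → S₂ ≤ S → S ≤ S₁ ⊔ S₂ → S₁ = S ∨ S₂ = S := by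
    intro S₁ S₂ h₁ h₂ h
    by_contra! hne
    exact hred ⟨S₁, S₂, lt_of_le_of_ne h₁ hne.1, lt_of_le_of_ne h₂ hne.2, h⟩
  have hle : ∀ x : A, x • S ≤ S := fun x ↦ by
    rintro _ ⟨y, hy, rfl⟩
    exact S.smul_mem x hy
  let q : Ideal A :=
    { carrier := {x | x • S ≠ S}
      zero_mem' := fun h ↦ hbot (by
        rw [← h, eq_bot_iff]
        rintro _ ⟨y, hy, rfl⟩
        simp)
      add_mem' := by
        intro x y hx hy h
        have : S ≤ x • S ⊔ y • S := by
          conv_lhs => rw [← h]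
          rintro _ ⟨z, hz, rfl⟩
          exact Submodule.mem_sup.2 ⟨x • z, ⟨z, hz, rfl⟩, y • z, ⟨z, hz, rfl⟩, (add_smul x y z).symm⟩
        exact (hirr _ _ (hle x) (hle y) this).elim hx hy
      smul_mem' := by
        intro c x hx h
        refine hx (le_antisymm (hle x) ?_)
        conv_lhs => rw [← h]
        rintro _ ⟨z, hz, rfl⟩
        exact ⟨c • z, S.smul_mem c hz, by simp [smul_smul]⟩ }
  have hq : ∀ x, x ∉ q ↔ x • S = S := fun x ↦ not_not
  have hqp : q.IsPrime := by
    refine ⟨fun h ↦ (hq 1).2 (one_smul _ _) (h ▸ Submodule.mem_top), fun {x y} hxy ↦ ?_⟩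
    by_contra! h
    exact (hq _).2 (by rw [mul_smul, (hq y).1 h.2, (hq x).1 h.1]) hxy
  by_cases hqm : q = maximalIdeal A
  · have hspan : ∀ s : Finset A, (∀ x ∈ s, x ∈ q) → ¬ S ≤ Ideal.span (s : Set A) • S := by
      intro s
      induction s using Finset.induction_on with
      | empty => simpa using hbot
      | insert a s _ ihs =>
        intro hs h
        rw [Finset.coe_insert, Ideal.span_insert, Submodule.sup_smul,
          Submodule.ideal_span_singleton_smul] at h
        rcases hirr _ _ (hle a) Submodule.smul_le_right h with h | h
        · exact hs a (Finset.mem_insert_self _ _) h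
        · exact ihs (fun x hx ↦ hs x (Finset.mem_insert_of_mem hx)) h.ge
    obtain ⟨s, hs⟩ := (isNoetherianRing_iff_ideal_fg A).1 ‹_› (maximalIdeal A)
    have hm : ¬ S ≤ maximalIdeal A • S := by
      rw [← hs]
      exact hspan s fun x hx ↦ hqm ▸ hs ▸ Ideal.subset_span hx
    obtain ⟨F, hFS, hF, h⟩ := S.exists_fg_sup_maximalIdeal_smul
    have hFS' : F = S :=
      (hirr _ _ hFS Submodule.smul_le_right h).resolve_right fun h' ↦ hm h'.ge
    exact ⟨∅, by simp, fun x _ ↦ ⟨F, hF, hFS'.ge.trans le_sup_left⟩⟩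
  · exact ⟨{q}, by simpa using ⟨hqp, hqm⟩, fun x hx ↦ ⟨⊥, Submodule.fg_bot, by
      rw [(hq x).1 (hx q (Finset.mem_singleton_self _))]; simp⟩⟩

end Artinian

lemma WithBot.lt_natCast_of_add_one_lt {a : WithBot ℕ∞} {n : ℕ} (h : a + 1 < (n + 1 : ℕ)) :
    a < n := by
  induction a using WithBot.recBotCoe with
  | bot => exact WithBot.bot_lt_coe (n : ℕ∞)
  | coe a =>
    have h' : a + 1 < (n : ℕ∞) + 1 := by exact_mod_cast h
    have : a < n := lt_of_add_lt_add_right h'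
    exact_mod_cast this

namespace LocalCohomologyModule

open IsLocalRing Pointwise

variable {A : Type u} [CommRing A] (b : Ideal A)

section Regular

variable {N : Type u} [AddCommGroup N] [Module A N] {x : A}

lemma exact_lsmul_mkQ : Function.Exact (LinearMap.lsmul A N x)
    (Submodule.mkQ (x • ⊤ : Submodule A N)) := by
  intro y
  rw [Submodule.mkQ_apply, Submodule.Quotient.mk_eq_zero]
  constructor
  · rintro ⟨z, _, hz⟩
    exact ⟨z, hz⟩
  · rintro ⟨z, rfl⟩
    exact ⟨z, trivial, rfl⟩

lemma smul_eq_zero_iff_of_regular (hx : IsSMulRegular N x) (i : ℕ)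
    (z : LocalCohomologyModule b (i + 1) N) :
    x • z = 0 ↔ z ∈ LinearMap.range (connecting b (f := LinearMap.lsmul A N x) hx
      (Submodule.mkQ_surjective (x • ⊤ : Submodule A N)) exact_lsmul_mkQ i) := by
  rw [← map_lsmul]
  exact exact₁ b (f := LinearMap.lsmul A N x) hx (Submodule.mkQ_surjective _) exact_lsmul_mkQ i z

lemma map_mkQ_surjective_of_subsingleton (hx : IsSMulRegular N x) (i : ℕ)
    [Subsingleton (LocalCohomologyModule b (i + 1) N)] :
    Function.Surjective (map b (Submodule.mkQ (x • ⊤ : Submodule A N)) i) := fun z ↦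
  (exact₃ b (f := LinearMap.lsmul A N x) hx (Submodule.mkQ_surjective _) exact_lsmul_mkQ i z).1
    (Subsingleton.elim _ _)

lemma smul_surjective_of_subsingleton (hx : IsSMulRegular N x) (i : ℕ)
    [Subsingleton (LocalCohomologyModule b i (QuotSMulTop x N))]
    (z : LocalCohomologyModule b i N) : ∃ w, x • w = z := by
  obtain ⟨w, hw⟩ := (exact₂ b (f := LinearMap.lsmul A N x) hx (Submodule.mkQ_surjective _)
    exact_lsmul_mkQ i z).1 (Subsingleton.elim (α := LocalCohomologyModule b i (QuotSMulTop x N)) _ _)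
  exact ⟨w, by rw [← map_lsmul, hw]⟩

end Regular

variable [IsLocalRing A]

section

variable (N : Type u) [AddCommGroup N] [Module A N]

lemma le_radical_of_le {N N' : Type u} [AddCommGroup N] [Module A N] [AddCommGroup N'] [Module A N']
    (h : Module.annihilator A N ≤ Module.annihilator A N')
    (hN : maximalIdeal A ≤ (b ⊔ Module.annihilator A N).radical) :
    maximalIdeal A ≤ (b ⊔ Module.annihilator A N').radical :=
  hN.trans (Ideal.radical_mono (sup_le_sup_left h b))

lemma le_radical_quotient (S : Submodule A N)
    (hN : maximalIdeal A ≤ (b ⊔ Module.annihilator A N).radical) :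
    maximalIdeal A ≤ (b ⊔ Module.annihilator A (N ⧸ S)).radical :=
  le_radical_of_le b (LinearMap.annihilator_le_of_surjective S.mkQ S.mkQ_surjective) hN

lemma exists_pow_smul_eq_zero_of_mem (hN : maximalIdeal A ≤ (b ⊔ Module.annihilator A N).radical)
    {x : A} (hx : x ∈ maximalIdeal A) (i : ℕ) (z : LocalCohomologyModule b i N) :
    ∃ n : ℕ, x ^ n • z = 0 := by
  obtain ⟨n, hn⟩ := exists_pow_smul_eq_zero b i z
  obtain ⟨k, hk⟩ := hN hx
  obtain ⟨y, hy, w, hw, hyw⟩ := Submodule.mem_sup.1 hk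
  refine ⟨k * n, ?_⟩
  rw [pow_mul, ← hyw, add_pow, Finset.sum_smul]
  refine Finset.sum_eq_zero fun j hj ↦ ?_
  obtain rfl | hjn := (Finset.mem_range_succ_iff.1 hj).eq_or_lt
  · rw [mul_assoc, mul_comm, mul_smul, hn _ (Ideal.pow_mem_pow hy _), smul_zero]
  · refine smul_eq_zero_of_mem_annihilator b ?_ i z
    exact Ideal.mul_mem_right _ _ (Ideal.mul_mem_left _ _ (Ideal.pow_mem_of_mem _ hw _ (by lia)))

variable [IsNoetherianRing A]

lemma exists_regular_of_powTorsion_eq_bot (hb : b ≤ maximalIdeal A)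
    [Module.Finite A N] (hN : b.powTorsion N = ⊥) (Q : Finset (Ideal A))
    (hQ : ∀ p ∈ Q, p.IsPrime ∧ p ≠ maximalIdeal A) :
    ∃ x ∈ maximalIdeal A, IsSMulRegular N x ∧ ∀ p ∈ Q, x ∉ p := by
  classical
  have hfin := (associatedPrimes.finite A N).union Q.finite_toSet
  have hprime : ∀ p ∈ associatedPrimes A N ∪ Q, p.IsPrime ∧ p ≠ maximalIdeal A := by
    rintro p (hp | hp)
    · refine ⟨hp.isPrime, ?_⟩
      rintro rfl
      obtain ⟨-, y, hy⟩ := isAssociatedPrime_iff.1 hp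
      have hmem : y ∈ b.powTorsion N := ⟨1, fun r hr ↦ by
        have := hy ▸ hb (pow_one b ▸ hr)
        simpa [Submodule.mem_colon_singleton] using this⟩
      rw [hN, Submodule.mem_bot] at hmem
      have h1 : (1 : A) ∈ maximalIdeal A := by
        rw [hy, Submodule.mem_colon_singleton, hmem, smul_zero]
        exact zero_mem _
      exact (Ideal.ne_top_iff_one _).1 (maximalIdeal.isMaximal A).ne_top h1
    · exact hQ p hp
  have h : ¬ ((maximalIdeal A : Set A) ⊆ ⋃ p ∈ associatedPrimes A N ∪ Q, (p : Set A)) := by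
    intro h
    obtain ⟨p, hp, hmp⟩ := (Ideal.subset_union_prime_finite hfin (f := id) ⊥ ⊥
      fun p hp _ _ ↦ (hprime p hp).1).1 h
    exact (hprime p hp).2 ((maximalIdeal.isMaximal A).eq_of_le (hprime p hp).1.ne_top hmp).symm
  obtain ⟨x, hx, hxp⟩ := Set.not_subset.1 h
  simp only [Set.mem_iUnion, not_exists] at hxp
  refine ⟨x, hx, ?_, fun p hp ↦ hxp p (Or.inr hp)⟩
  by_contra hreg
  have : x ∈ ⋃ p ∈ associatedPrimes A N, (p : Set A) := by
    rw [biUnion_associatedPrimes_eq_compl_regular]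
    exact hreg
  simp only [Set.mem_iUnion] at this
  obtain ⟨p, hp, hxp'⟩ := this
  exact hxp p (Or.inl hp) hxp'

lemma subsingleton_of_supportDim_lt (hb : b ≤ maximalIdeal A) [Module.Finite A N]
    (hN : maximalIdeal A ≤ (b ⊔ Module.annihilator A N).radical) (i : ℕ)
    (hi : Module.supportDim A N < i) : Subsingleton (LocalCohomologyModule b i N) := by
  induction i generalizing N with
  | zero =>
    have : Subsingleton N := by
      by_contra h
      rw [← Module.supportDim_eq_bot_iff_subsingleton (R := A)] at h
      rw [Nat.cast_zero] at hi
      exact h ((WithBot.lt_zero_iff_eq_bot _).1 hi)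
    exact subsingleton_of_subsingleton b 0
  | succ i ih =>
    refine (quotientPowTorsionEquiv b i N).toEquiv.subsingleton_congr.2 ?_
    obtain ⟨x, hxm, hx, -⟩ := exists_regular_of_powTorsion_eq_bot b (N ⧸ b.powTorsion N)
      hb b.powTorsion_quotient_eq_bot ∅ (by simp)
    have hN' := le_radical_quotient b N (b.powTorsion N) hN
    have hdim : Module.supportDim A (QuotSMulTop x (N ⧸ b.powTorsion N)) < i := by
      have h1 := Module.supportDim_quotSMulTop_succ_eq_supportDim hx hxm
      have h2 := Module.supportDim_le_of_surjective (b.powTorsion N).mkQ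
        (Submodule.mkQ_surjective _)
      exact WithBot.lt_natCast_of_add_one_lt (h1.trans_le h2 |>.trans_lt hi)
    have := ih (QuotSMulTop x (N ⧸ b.powTorsion N)) (le_radical_quotient b _ _ hN') hdim
    have hinj (z : LocalCohomologyModule b (i + 1) (N ⧸ b.powTorsion N)) (hz : x • z = 0) :
        z = 0 := by
      obtain ⟨w, rfl⟩ := (smul_eq_zero_iff_of_regular b hx i z).1 hz
      rw [Subsingleton.elim (α := LocalCohomologyModule b i (QuotSMulTop x (N ⧸ b.powTorsion N))) w 0,
        map_zero]
    refine subsingleton_of_forall_eq 0 fun z ↦ ?_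
    obtain ⟨n, hn⟩ := exists_pow_smul_eq_zero_of_mem b _ hN' hxm _ z
    induction n with
    | zero => simpa using hn
    | succ n ihn => exact ihn (hinj _ (by rw [smul_smul, ← pow_succ', hn]))

lemma le_radical_annihilator_powTorsion [Module.Finite A N]
    (hN : maximalIdeal A ≤ (b ⊔ Module.annihilator A N).radical) :
    maximalIdeal A ≤ (Module.annihilator A (b.powTorsion N)).radical := by
  refine hN.trans ?_
  rw [← Ideal.radical_idem (Module.annihilator A (b.powTorsion N))]
  refine Ideal.radical_mono (sup_le (fun r hr ↦ ?_) ((LinearMap.annihilator_le_of_injective _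
    (b.powTorsion N).injective_subtype).trans Ideal.le_radical))
  obtain ⟨n, hn⟩ := b.exists_pow_smul_eq_zero_of_fg
    (Module.Finite.iff_fg.1 inferInstance) (le_refl (b.powTorsion N))
  exact ⟨n, Module.mem_annihilator.2 fun z ↦
    Subtype.ext (hn _ (Ideal.pow_mem_pow hr n) z.1 z.2)⟩

lemma isArtinian (hb : b ≤ maximalIdeal A) [Module.Finite A N]
    (hN : maximalIdeal A ≤ (b ⊔ Module.annihilator A N).radical) (i : ℕ) :
    IsArtinian A (LocalCohomologyModule b i N) := by
  induction i generalizing N with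
  | zero =>
    have : IsArtinian A (b.powTorsion N) :=
      isArtinian_of_maximalIdeal_le_radical_annihilator (le_radical_annihilator_powTorsion b N hN)
    rw [← range_eval] at this
    exact isArtinian_of_linearEquiv (LinearEquiv.ofInjective _ (eval_injective b)).symm
  | succ i ih =>
    refine @isArtinian_of_linearEquiv _ _ _ _ _ _ _ _ (quotientPowTorsionEquiv b i N).symm ?_
    obtain ⟨x, hxm, hx, -⟩ := exists_regular_of_powTorsion_eq_bot b (N ⧸ b.powTorsion N)
      hb b.powTorsion_quotient_eq_bot ∅ (by simp)
    have hN' := le_radical_quotient b N (b.powTorsion N) hN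
    have := ih (QuotSMulTop x (N ⧸ b.powTorsion N)) (le_radical_quotient b _ _ hN')
    have hker : LinearMap.ker (LinearMap.lsmul A
        (LocalCohomologyModule b (i + 1) (N ⧸ b.powTorsion N)) x) =
        LinearMap.range (connecting b (f := LinearMap.lsmul A (N ⧸ b.powTorsion N) x) hx
      (Submodule.mkQ_surjective _) exact_lsmul_mkQ i) := by
      ext z
      exact smul_eq_zero_iff_of_regular b hx i z
    have : IsArtinian A (LinearMap.ker (LinearMap.lsmul A
        (LocalCohomologyModule b (i + 1) (N ⧸ b.powTorsion N)) x)) := by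
      rw [hker]
      exact @isArtinian_of_surjective _ _ _ _ _ _ _ _ _ (LinearMap.surjective_rangeRestrict _) this
    exact isArtinian_of_isArtinian_ker_lsmul x
      fun z ↦ exists_pow_smul_eq_zero_of_mem b _ hN' hxm _ z

end

end LocalCohomologyModule

lemma WithBot.eq_natCast_of_add_one_eq {a : WithBot ℕ∞} {n : ℕ} (h : a + 1 = (n + 1 : ℕ)) :
    a = n := by
  induction a using WithBot.recBotCoe with
  | bot => exact absurd h (by rw [WithBot.bot_add]; exact (WithBot.bot_lt_coe ((n + 1 : ℕ) : ℕ∞)).ne)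
  | coe a =>
    have h' : a + 1 = (n : ℕ∞) + 1 := by exact_mod_cast h
    have : a = n := by simpa using h'
    exact_mod_cast this

namespace LocalCohomologyModule

open IsLocalRing Pointwise

variable {A : Type u} [CommRing A] (b : Ideal A) [IsLocalRing A] [IsNoetherianRing A]
  {N : Type u} [AddCommGroup N] [Module A N] [Module.Finite A N]

lemma support_powTorsion_subset (hN : maximalIdeal A ≤ (b ⊔ Module.annihilator A N).radical) :
    Module.support A (b.powTorsion N) ⊆ {closedPoint A} := fun p hp ↦ by
  have h := (le_radical_annihilator_powTorsion b N hN).trans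
    (p.2.radical_le_iff.2 (Module.annihilator_le_of_mem_support hp))
  exact PrimeSpectrum.ext ((maximalIdeal.isMaximal A).eq_of_le p.2.ne_top h).symm

lemma supportDim_quotient_powTorsion
    (hN : maximalIdeal A ≤ (b ⊔ Module.annihilator A N).radical) (hpos : 0 < Module.supportDim A N) :
    Module.supportDim A (N ⧸ b.powTorsion N) = Module.supportDim A N := by
  have hs := Module.support_of_exact (LinearMap.exact_subtype_mkQ (b.powTorsion N))
    (b.powTorsion N).injective_subtype (b.powTorsion N).mkQ_surjective
  have hsub := support_powTorsion_subset b hN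
  have hne : Nontrivial (N ⧸ b.powTorsion N) := by
    by_contra h
    rw [not_nontrivial_iff_subsingleton] at h
    rw [Module.support_eq_empty (M := N ⧸ b.powTorsion N), Set.union_empty] at hs
    rw [← hs] at hsub
    have : Subsingleton (Module.support A N) := Set.subsingleton_coe _ |>.2
      (Set.subsingleton_singleton.anti hsub)
    exact hpos.not_ge Order.krullDim_nonpos_of_subsingleton
  have : Module.support A (N ⧸ b.powTorsion N) = Module.support A N := by
    rw [hs, Set.union_eq_right.2]
    refine hsub.trans (Set.singleton_subset_iff.2 ?_)
    exact IsLocalRing.closedPoint_mem_support A _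
  unfold Module.supportDim
  rw [this]

lemma exists_regular_of_finite (hb : b ≤ maximalIdeal A)
    (hN : maximalIdeal A ≤ (b ⊔ Module.annihilator A N).radical) (s : ℕ)
    (hs : Module.supportDim A N = (s + 1 : ℕ))
    (hfin : Module.Finite A (LocalCohomologyModule b (s + 1) N)) (Q : Finset (Ideal A))
    (hQ : ∀ p ∈ Q, p.IsPrime ∧ p ≠ maximalIdeal A) :
    ∃ x ∈ maximalIdeal A, (∀ p ∈ Q, x ∉ p) ∧
      Module.supportDim A (QuotSMulTop x (N ⧸ b.powTorsion N)) = s ∧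
      Function.Surjective (map b (Submodule.mkQ (x • ⊤ : Submodule A (N ⧸ b.powTorsion N))) s) := by
  have hN' := le_radical_quotient b N (b.powTorsion N) hN
  obtain ⟨x, hxm, hx, hxQ⟩ := exists_regular_of_powTorsion_eq_bot b (N ⧸ b.powTorsion N)
    hb b.powTorsion_quotient_eq_bot Q hQ
  have hdim : Module.supportDim A (QuotSMulTop x (N ⧸ b.powTorsion N)) = s := by
    refine WithBot.eq_natCast_of_add_one_eq
      ((Module.supportDim_quotSMulTop_succ_eq_supportDim hx hxm).trans ?_)
    rw [supportDim_quotient_powTorsion b hN (by rw [hs]; exact_mod_cast s.succ_pos), hs]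
  refine ⟨x, hxm, hxQ, hdim, ?_⟩
  have := Module.Finite.equiv (quotientPowTorsionEquiv b s N)
  have := subsingleton_of_supportDim_lt b (QuotSMulTop x (N ⧸ b.powTorsion N)) hb
    (le_radical_quotient b _ _ hN') (s + 1) (by rw [hdim]; exact_mod_cast s.lt_succ_self)
  have hsurj := smul_surjective_of_subsingleton b hx (s + 1)
  have hbot : (⊤ : Submodule A (LocalCohomologyModule b (s + 1) (N ⧸ b.powTorsion N))) = ⊥ := by
    refine Submodule.eq_bot_of_le_smul_of_le_jacobson_bot (maximalIdeal A) ⊤ Module.Finite.fg_top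
      (fun z _ ↦ ?_) (maximalIdeal_le_jacobson _)
    obtain ⟨w, rfl⟩ := hsurj z
    exact Submodule.smul_mem_smul hxm trivial
  have := (Submodule.subsingleton_iff A).1 (subsingleton_of_bot_eq_top hbot.symm)
  exact map_mkQ_surjective_of_subsingleton b hx s

theorem not_finite_of_supportDim_eq (hb : b ≤ maximalIdeal A)
    (hN : maximalIdeal A ≤ (b ⊔ Module.annihilator A N).radical) (s : ℕ)
    (hs : Module.supportDim A N = (s + 1 : ℕ)) :
    ¬ Module.Finite A (LocalCohomologyModule b (s + 1) N) := by
  intro hfin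
  have hN' := le_radical_quotient b N (b.powTorsion N) hN
  induction s generalizing N with
  | zero =>
    obtain ⟨x, hxm, -, hdim, hsurj⟩ := exists_regular_of_finite b hb hN 0 hs hfin ∅ (by simp)
    have := (subsingleton_zero_iff b).2 (b.powTorsion_quotient_eq_bot (M := N))
    obtain ⟨y, hym, hy, -⟩ := exists_regular_of_powTorsion_eq_bot b
      (QuotSMulTop x (N ⧸ b.powTorsion N)) hb ((subsingleton_zero_iff b).1 hsurj.subsingleton)
      ∅ (by simp)
    have h := Module.supportDim_quotSMulTop_succ_eq_supportDim hy hym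
    rw [hdim] at h
    have hlt := WithBot.lt_natCast_of_add_one_lt (n := 0) (by rw [h]; exact_mod_cast zero_lt_one)
    rw [Nat.cast_zero, WithBot.lt_zero_iff_eq_bot] at hlt
    rw [hlt] at h
    exact absurd h (by decide)
  | succ s ih =>
    have := isArtinian b _ hb hN' (s + 1)
    obtain ⟨Q, hQ, hF⟩ := IsArtinian.exists_finset_prime_forall_fg_sup_smul
      (⊤ : Submodule A (LocalCohomologyModule b (s + 1) (N ⧸ b.powTorsion N)))
    obtain ⟨x, hxm, hxQ, hdim, hsurj⟩ := exists_regular_of_finite b hb hN (s + 1) hs hfin Q hQ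
    obtain ⟨F, hFfg, hle⟩ := hF x hxQ
    have hN'' := le_radical_quotient b _ (x • ⊤ : Submodule A (N ⧸ b.powTorsion N)) hN'
    refine ih hN'' hdim ⟨?_⟩ (le_radical_quotient b _ _ hN'')
    convert hFfg.map (map b (Submodule.mkQ (x • ⊤ : Submodule A (N ⧸ b.powTorsion N))) (s + 1))
    refine eq_comm.1 (eq_top_iff.2 fun z _ ↦ ?_)
    obtain ⟨w, rfl⟩ := hsurj z
    obtain ⟨f, hf, v, hv, rfl⟩ := Submodule.mem_sup.1 (hle (Submodule.mem_top (x := w)))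
    obtain ⟨v, -, rfl⟩ := hv
    refine ⟨f, hf, ?_⟩
    rw [map_add, left_eq_add]
    refine (map_smul _ x v).trans (smul_eq_zero_of_mem_annihilator b
      (M := QuotSMulTop x (N ⧸ b.powTorsion N)) (QuotSMulTop.mem_annihilator _ x) _ _)

end LocalCohomologyModule

namespace LocalizedModule

variable {R : Type*} [CommRing R] (S : Submonoid R) (I : Ideal R)
  {M N P : Type*} [AddCommGroup M] [Module R M] [AddCommGroup N] [Module R N]
  [AddCommGroup P] [Module R P]

lemma map_injective_of_injective {f : M →ₗ[R] N} (hf : Function.Injective f) :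
    Function.Injective (LocalizedModule.map S f) :=
  IsLocalizedModule.map_injective S (mkLinearMap S M) (mkLinearMap S N) f hf

lemma map_surjective_of_surjective {f : M →ₗ[R] N} (hf : Function.Surjective f) :
    Function.Surjective (LocalizedModule.map S f) :=
  IsLocalizedModule.map_surjective S (mkLinearMap S M) (mkLinearMap S N) f hf

lemma map_exact_of_exact {f : M →ₗ[R] N} {g : N →ₗ[R] P} (h : Function.Exact f g) :
    Function.Exact (LocalizedModule.map S f) (LocalizedModule.map S g) :=
  LocalizedModule.map_exact S f g h

lemma map_mkLinearMap (f : M →ₗ[R] N) (x : M) :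
    LocalizedModule.map S f (mkLinearMap S M x) = mkLinearMap S N (f x) :=
  IsLocalizedModule.map_apply S (mkLinearMap S M) (mkLinearMap S N) f x

variable {S I} in
lemma mkLinearMap_mem_powTorsion {x : M} (hx : x ∈ I.powTorsion M) :
    mkLinearMap S M x ∈ (I.map (algebraMap R (Localization S))).powTorsion (LocalizedModule S M) := by
  obtain ⟨n, hn⟩ := hx
  refine ⟨n, ?_⟩
  rw [← Ideal.map_pow]
  change Ideal.map _ _ ≤ LinearMap.ker (LinearMap.toSpanSingleton (Localization S) _ _)
  rw [Ideal.map_le_iff_le_comap]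
  intro r hr
  change algebraMap R (Localization S) r • mkLinearMap S M x = 0
  rw [algebraMap_smul, ← map_smul, hn r hr, map_zero]

variable {S I} in
lemma exists_smul_mem_powTorsion [IsNoetherianRing R] {y : LocalizedModule S M}
    (hy : y ∈ (I.map (algebraMap R (Localization S))).powTorsion (LocalizedModule S M)) :
    ∃ s : S, ∃ x ∈ I.powTorsion M, (s : R) • y = mkLinearMap S M x := by
  obtain ⟨n, hn⟩ := hy
  rw [← Ideal.map_pow] at hn
  obtain ⟨⟨x, s⟩, rfl⟩ := IsLocalizedModule.mk'_surjective S (mkLinearMap S M) y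
  obtain ⟨T, hT⟩ := (isNoetherianRing_iff_ideal_fg R).1 ‹_› (I ^ n)
  have h1 (r) (hr : r ∈ T) : ∃ u : S, u • r • x = 0 := by
    have := hn _ (Ideal.mem_map_of_mem _ (hT.le (Submodule.subset_span hr)))
    rw [algebraMap_smul, Function.uncurry_apply_pair, ← IsLocalizedModule.mk'_smul,
      IsLocalizedModule.mk'_eq_zero'] at this
    exact this
  classical
  choose! u hu using h1
  refine ⟨(∏ r ∈ T, u r) * s, (∏ r ∈ T, u r) • x, ⟨n, fun r hr ↦ ?_⟩, ?_⟩
  · rw [← hT] at hr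
    induction hr using Submodule.span_induction with
    | mem r hr =>
      rw [smul_comm, ← Finset.prod_erase_mul _ _ hr, mul_smul, hu r hr, smul_zero]
    | zero => rw [zero_smul]
    | add a b _ _ ha hb => rw [add_smul, ha, hb, add_zero]
    | smul a b _ hb => rw [smul_eq_mul, mul_smul, hb, smul_zero]
  · rw [Submonoid.coe_mul, mul_smul, Function.uncurry_apply_pair]
    erw [IsLocalizedModule.mk'_cancel' (mkLinearMap S M) x s]
    rw [← map_smul]
    rfl

end LocalizedModule

namespace LocalCohomologyModule

open LocalizedModule

lemma finite_one_iff {R : Type u} [CommRing R] (I : Ideal R)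
    {M E C : Type u} [AddCommGroup M] [Module R M] [AddCommGroup E] [Module R E]
    [AddCommGroup C] [Module R C] [Module.Injective R E] {f : M →ₗ[R] E} {g : E →ₗ[R] C}
    (hf : Function.Injective f) (hg : Function.Surjective g) (hfg : Function.Exact f g) :
    Module.Finite R (LocalCohomologyModule I 1 M) ↔
      ∃ T : Finset C, (T : Set C) ⊆ I.powTorsion C ∧
        I.powTorsion C ≤ (I.powTorsion E).map g ⊔ Submodule.span R (T : Set C) := by
  have := subsingleton_of_injective I (M := E) 0
  have hδ (z : LocalCohomologyModule I 1 M) : ∃ w, connecting I hf hg hfg 0 w = z :=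
    (exact₁ I hf hg hfg 0 z).1 (Subsingleton.elim _ _)
  constructor
  · rintro ⟨T, hT⟩
    classical
    choose w hw using hδ
    refine ⟨T.image fun z ↦ eval I C (w z), ?_, ?_⟩
    · rw [Finset.coe_image]
      rintro _ ⟨z, -, rfl⟩
      exact exists_pow_smul_eval_eq_zero I _
    · intro c hc
      rw [← range_eval] at hc
      obtain ⟨v, rfl⟩ := hc
      have h1 : connecting I hf hg hfg 0 v ∈ (Submodule.span R ((T.image w : Finset _) : Set
          (LocalCohomologyModule I 0 C))).map (connecting I hf hg hfg 0) := by
        rw [Submodule.map_span, Finset.coe_image, ← Set.image_comp,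
          show (⇑(connecting I hf hg hfg 0) ∘ w) = id from funext hw, Set.image_id, hT]
        trivial
      obtain ⟨v', hv', hvv'⟩ := h1
      have h2 : connecting I hf hg hfg 0 (v - v') = 0 := by rw [map_sub, hvv', sub_self]
      obtain ⟨e, he⟩ := (exact₃ I hf hg hfg 0 _).1 h2
      rw [show v = (v - v') + v' by abel, map_add, ← he, eval_map]
      refine Submodule.add_mem_sup ⟨_, exists_pow_smul_eval_eq_zero I e, rfl⟩ ?_
      have := Submodule.mem_map_of_mem (f := eval I C) hv'
      rw [Submodule.map_span, Finset.coe_image, ← Set.image_comp] at this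
      rw [Finset.coe_image]
      exact this
  · rintro ⟨T, hTΓ, hT⟩
    have hfg' : ((Submodule.span R (T : Set C)).comap (eval I C)).FG := by
      refine Submodule.fg_of_fg_map_injective (eval I C) (eval_injective I) ?_
      rw [Submodule.map_comap_eq, range_eval, inf_eq_right.2 (Submodule.span_le.2 hTΓ)]
      exact ⟨T, rfl⟩
    refine ⟨?_⟩
    convert hfg'.map (connecting I hf hg hfg 0)
    refine eq_comm.1 (eq_top_iff.2 fun z _ ↦ ?_)
    obtain ⟨w, rfl⟩ := hδ z
    obtain ⟨_, ⟨e, he, rfl⟩, c, hc, hec⟩ := Submodule.mem_sup.1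
      (hT (exists_pow_smul_eval_eq_zero I w))
    rw [← range_eval] at he
    obtain ⟨e, rfl⟩ := he
    refine ⟨w - map I g 0 e, ?_, ?_⟩
    · rw [SetLike.mem_coe, Submodule.mem_comap, map_sub, eval_map, ← hec, add_sub_cancel_left]
      exact hc
    · rw [map_sub, (exact₃ I hf hg hfg 0 _).2 ⟨e, rfl⟩, sub_zero]

variable {R : Type u} [CommRing R] [IsNoetherianRing R] (S : Submonoid R) (I : Ideal R)

lemma finite_localizedModule (i : ℕ) (M : Type u) [AddCommGroup M] [Module R M]
    (h : Module.Finite R (LocalCohomologyModule I (i + 1) M)) :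
    Module.Finite (Localization S) (LocalCohomologyModule (I.map (algebraMap R (Localization S)))
      (i + 1) (LocalizedModule S M)) := by
  set A := Localization S
  set J := I.map (algebraMap R A)
  induction i generalizing M with
  | zero =>
    obtain ⟨E, _, _, f, _, hf⟩ := Module.exists_injective_linearMap (R := R) M
    have hg := (LinearMap.range f).mkQ_surjective
    have hfg := LinearMap.exact_map_mkQ_range f
    have : Module.Injective A (LocalizedModule S E) :=
      Module.injective_of_isLocalizedModule S (mkLinearMap S E)
    obtain ⟨T, hTΓ, hT⟩ := (finite_one_iff I hf hg hfg).1 h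
    classical
    refine (finite_one_iff J (map_injective_of_injective S hf) (map_surjective_of_surjective S hg)
      (map_exact_of_exact S hfg)).2 ⟨T.image (mkLinearMap S _), ?_, fun y hy ↦ ?_⟩
    · rw [Finset.coe_image]
      rintro _ ⟨c, hc, rfl⟩
      exact mkLinearMap_mem_powTorsion (hTΓ hc)
    · obtain ⟨s, c, hc, hy⟩ := exists_smul_mem_powTorsion hy
      have hmem : mkLinearMap S _ c ∈ (J.powTorsion (LocalizedModule S E)).map
          (LocalizedModule.map S (LinearMap.range f).mkQ) ⊔
          Submodule.span A (T.image (mkLinearMap S _) : Set (LocalizedModule S _)) := by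
        obtain ⟨_, ⟨e, he, rfl⟩, c', hc', rfl⟩ := Submodule.mem_sup.1 (hT hc)
        rw [map_add, ← map_mkLinearMap]
        refine Submodule.add_mem_sup ⟨_, mkLinearMap_mem_powTorsion he, rfl⟩ ?_
        have := Submodule.mem_map_of_mem (f := mkLinearMap S _) hc'
        rw [Submodule.map_span] at this
        rw [Finset.coe_image]
        exact Submodule.span_subset_span R A _ this
      rw [← hy, ← algebraMap_smul A] at hmem
      exact (Submodule.smul_mem_iff_of_isUnit _ (IsLocalization.map_units A s)).1 hmem
  | succ i ih =>
    obtain ⟨E, _, _, f, _, hf⟩ := Module.exists_injective_linearMap (R := R) M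
    have hg := (LinearMap.range f).mkQ_surjective
    have hfg := LinearMap.exact_map_mkQ_range f
    have : Module.Injective A (LocalizedModule S E) :=
      Module.injective_of_isLocalizedModule S (mkLinearMap S E)
    have h1 := subsingleton_of_injective I (M := E) i
    have h2 := subsingleton_of_injective J (M := LocalizedModule S E) (i + 1)
    have hinj : Function.Injective (connecting I hf hg hfg (i + 1)) := by
      refine (injective_iff_map_eq_zero _).2 fun z hz ↦ ?_
      obtain ⟨w, rfl⟩ := (exact₃ I hf hg hfg (i + 1) z).1 hz
      rw [Subsingleton.elim w 0, map_zero]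
    have hsurj : Function.Surjective (connecting J (map_injective_of_injective S hf)
        (map_surjective_of_surjective S hg) (map_exact_of_exact S hfg) (i + 1)) := fun z ↦
      (exact₁ J _ _ _ (i + 1) z).1 (Subsingleton.elim _ _)
    have := ih _ (Module.Finite.of_injective _ hinj)
    exact Module.Finite.of_surjective _ hsurj

end LocalCohomologyModule

section Support

variable {R : Type*} [CommRing R] {M : Type*} [AddCommGroup M] [Module R M]

lemma Module.mem_support_localizedModule_iff (S : Submonoid R)
    {P : PrimeSpectrum (Localization S)} :
    P ∈ Module.support (Localization S) (LocalizedModule S M) ↔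
      PrimeSpectrum.comap (algebraMap R (Localization S)) P ∈ Module.support R M := by
  simp only [Module.mem_support_iff', PrimeSpectrum.comap_asIdeal, Ideal.mem_comap]
  constructor
  · rintro ⟨y, hy⟩
    obtain ⟨⟨x, s⟩, rfl⟩ := IsLocalizedModule.mk'_surjective S (LocalizedModule.mkLinearMap S M) y
    refine ⟨x, fun r hr h ↦ hy _ hr ?_⟩
    rw [Function.uncurry_apply_pair, algebraMap_smul, ← IsLocalizedModule.mk'_smul, h,
      IsLocalizedModule.mk'_zero]
  · rintro ⟨x, hx⟩
    refine ⟨LocalizedModule.mkLinearMap S M x, fun a ha h ↦ ?_⟩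
    obtain ⟨r, s, rfl⟩ := IsLocalization.exists_mk'_eq S a
    have hs := IsLocalization.map_units (Localization S) s
    have hr : algebraMap R (Localization S) r ∉ P.asIdeal := by
      rw [← IsLocalization.mk'_spec (Localization S) r s]
      exact fun hmem ↦ (P.2.mem_or_mem hmem).elim ha
        fun h ↦ P.2.ne_top (Ideal.eq_top_of_isUnit_mem _ h hs)
    have h0 : LocalizedModule.mkLinearMap S M (r • x) = 0 := by
      rw [map_smul, ← algebraMap_smul (Localization S) r,
        ← IsLocalization.mk'_spec (Localization S) r s, mul_comm, mul_smul, h, smul_zero]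
    obtain ⟨u, hu⟩ := (IsLocalizedModule.eq_zero_iff S (LocalizedModule.mkLinearMap S M)).1 h0
    refine hx (u * r) (fun hmem ↦ ?_) (by rw [mul_smul]; exact hu)
    rw [map_mul] at hmem
    exact (P.2.mem_or_mem hmem).elim (fun h ↦ P.2.ne_top
      (Ideal.eq_top_of_isUnit_mem _ h (IsLocalization.map_units (Localization S) u))) hr

lemma Module.supportDim_localizedModule_atPrime (p : Module.support R M) :
    Module.supportDim (Localization.AtPrime p.1.asIdeal)
      (LocalizedModule p.1.asIdeal.primeCompl M) = Order.height p := by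
  rw [Order.height_eq_krullDim_Iic]
  let e := IsLocalization.AtPrime.primeSpectrumOrderIso (Localization.AtPrime p.1.asIdeal) p.1.asIdeal
  have he (P) : (e P).1 = PrimeSpectrum.comap (algebraMap R _) P := rfl
  let f : Module.support (Localization.AtPrime p.1.asIdeal)
      (LocalizedModule p.1.asIdeal.primeCompl M) ↪o Set.Iic p :=
    OrderEmbedding.ofMapLEIff (fun P ↦ ⟨⟨(e P.1).1, Module.mem_support_localizedModule_iff _ |>.1 P.2⟩,
      (e P.1).2⟩) fun P Q ↦ e.le_iff_le
  refine Order.krullDim_eq_of_orderIso (RelIso.ofSurjective f fun q ↦ ?_)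
  refine ⟨⟨e.symm ⟨q.1.1, q.2⟩, (Module.mem_support_localizedModule_iff _).2 ?_⟩, ?_⟩
  · rw [← he, e.apply_symm_apply]
    exact q.1.2
  · have h : (e (e.symm ⟨q.1.1, q.2⟩)).1 = q.1.1 := by rw [e.apply_symm_apply]
    exact Subtype.ext (Subtype.ext h)

end Support

lemma exists_height_eq_of_eq_moduleHeight {R : Type u} [CommRing R] {𝔞 : Ideal R} {M : Type u}
    [AddCommGroup M] [Module R M] {t : ℕ} (h : (t : WithBot ℕ∞) = moduleHeight R M 𝔞) :
    ∃ p : Module.support R M, 𝔞 ≤ p.1.asIdeal ∧ Order.height p = t ∧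
      ∀ q : Module.support R M, 𝔞 ≤ q.1.asIdeal → t ≤ Order.height q := by
  have hmem := csInf_mem (s := { d : WithBot ℕ∞ | ∃ 𝔭 ∈ Module.support R M, 𝔞 ≤ 𝔭.asIdeal ∧
    d = moduleKrullDim (Localization.AtPrime 𝔭.asIdeal) (LocalizedModule 𝔭.asIdeal.primeCompl M) })
    (by
      by_contra hne
      rw [Set.not_nonempty_iff_eq_empty] at hne
      rw [moduleHeight, hne, sInf_empty] at h
      exact (WithBot.coe_injective h).not_lt (ENat.natCast_lt_top t))
  change moduleHeight R M 𝔞 ∈ _ at hmem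
  rw [← h] at hmem
  obtain ⟨p, hp, hap, hdim⟩ := hmem
  refine ⟨⟨p, hp⟩, hap, ?_, fun q hq ↦ ?_⟩
  · have := Module.supportDim_localizedModule_atPrime ⟨p, hp⟩
    have := this.symm.trans hdim.symm
    exact_mod_cast this
  · have : moduleHeight R M 𝔞 ≤ Order.height q :=
      sInf_le ⟨q.1, q.2, hq, (Module.supportDim_localizedModule_atPrime q).symm⟩
    rw [← h] at this
    exact_mod_cast this

theorem not_finite_localCohomology_height
    {R : Type u} [CommRing R] [IsNoetherianRing R]
    (𝔞 : Ideal R) (M : Type u) [AddCommGroup M] [Module R M] [Module.Finite R M] [Nontrivial M]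
    (t : ℕ) (h_pos : 0 < t) (h_eq : (t : WithBot ℕ∞) = moduleHeight R M 𝔞) :
    ¬ Module.Finite R ((localCohomology 𝔞 t).obj (ModuleCat.of R M)) := by
  intro hfin
  obtain ⟨p, hap, hpt, hmin⟩ := exists_height_eq_of_eq_moduleHeight h_eq
  obtain ⟨s, rfl⟩ := Nat.exists_eq_succ_of_ne_zero h_pos.ne'
  obtain ⟨f, hf⟩ := LocalCohomologyModule.exists_surjective_of_localCohomology (M := M) 𝔞 s
  have hR := Module.Finite.of_surjective f hf
  refine LocalCohomologyModule.not_finite_of_supportDim_eq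
    (𝔞.map (algebraMap R (Localization.AtPrime p.1.asIdeal)))
    (N := LocalizedModule p.1.asIdeal.primeCompl M) ?_ ?_ s ?_
    (LocalCohomologyModule.finite_localizedModule p.1.asIdeal.primeCompl 𝔞 s M hR)
  · exact Ideal.map_le_iff_le_comap.2
      (hap.trans (IsLocalization.AtPrime.under_maximalIdeal _ p.1.asIdeal).ge)
  · rw [Ideal.radical_eq_sInf]
    refine le_sInf fun P ⟨hP, hPprime⟩ ↦ ?_
    let P' : PrimeSpectrum (Localization.AtPrime p.1.asIdeal) := ⟨P, hPprime⟩
    have hP' : P' ∈ Module.support (Localization.AtPrime p.1.asIdeal)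
      (LocalizedModule p.1.asIdeal.primeCompl M) :=
      Module.mem_support_iff_of_finite.2 (le_sup_right.trans hP)
    have hle : P' ≤ IsLocalRing.closedPoint _ := le_top
    let q : Module.support R M := ⟨_, (Module.mem_support_localizedModule_iff _).1 hP'⟩
    have hclosed : PrimeSpectrum.comap (algebraMap R (Localization.AtPrime p.1.asIdeal))
        (IsLocalRing.closedPoint (Localization.AtPrime p.1.asIdeal)) = p.1 :=
      PrimeSpectrum.ext (IsLocalization.AtPrime.under_maximalIdeal _ p.1.asIdeal)
    have hqp : q ≤ p := by
      change q.1 ≤ p.1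
      rw [← hclosed]
      exact Ideal.comap_mono hle
    have hq : q = p := by
      by_contra hne
      have h1 := Order.height_strictMono (lt_of_le_of_ne hqp hne)
        ((Order.height_mono hqp).trans_lt (hpt ▸ ENat.natCast_lt_top _))
      rw [hpt] at h1
      exact h1.not_ge (hmin q (Ideal.map_le_iff_le_comap.1 (le_sup_left.trans hP)))
    have : P' = IsLocalRing.closedPoint _ :=
      PrimeSpectrum.localization_comap_injective _ p.1.asIdeal.primeCompl
        ((congrArg Subtype.val hq).trans hclosed.symm)
    exact (congrArg PrimeSpectrum.asIdeal this).ge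
  · rw [Module.supportDim_localizedModule_atPrime, hpt]
    rfl
end

section
/- Let R be a commutative Noetherian ring, 𝔞 an ideal of R, and N a finitely generated R-module of finite projective dimension n := pd N. Then f_𝔞(N) ≥ f_𝔞(R) − n; that is, for every integer i with i < f_𝔞(R) − n, the local cohomology module H^i_𝔞(N) is finitely generated. -/
/-!
STATEMENT 6: Let R be a commutative Noetherian ring, 𝔞 an ideal of R, and N a finitely
generated R-module of finite projective dimension n := pd N. Then f_𝔞(N) ≥ f_𝔞(R) − n; i.e.
for every integer i with i < f_𝔞(R) − n, the module H^i_𝔞(N) is finitely generated.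

We encode `pd N = n` by: `Ext^j_R(N, L) = 0` for every `R`-module `L` and every `j > n`, and
`Ext^n_R(N, L) ≠ 0` for some `L`.  The condition `i < f_𝔞(R) − n` (with `f_𝔞(R)` possibly
infinite) is encoded as: `H^j_𝔞(R)` is finitely generated for all `j ≤ i + n`.
-/

open CategoryTheory Opposite

universe u

open Limits

namespace CategoryTheory

section LeftDerived

variable {C : Type*} [Category* C] [Abelian C] 
  {D : Type*} [Category* D] [Abelian D]
  (S : ShortComplex (C ⥤ D)) [S.X₁.Additive] [S.X₂.Additive] [S.X₃.Additive]

/-- Apply a short complex of additive functors to a chain complex. -/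
@[simps]
def ShortComplex.mapChainComplex (K : ChainComplex C ℕ) :
    ShortComplex (ChainComplex D ℕ) where
  X₁ := (S.X₁.mapHomologicalComplex _).obj K
  X₂ := (S.X₂.mapHomologicalComplex _).obj K
  X₃ := (S.X₃.mapHomologicalComplex _).obj K
  f := (NatTrans.mapHomologicalComplex S.f _).app K
  g := (NatTrans.mapHomologicalComplex S.g _).app K
  zero := by
    ext n
    exact congr_app S.zero (K.X n)

/-- Functoriality of `ShortComplex.mapChainComplex` in the chain complex. -/
@[simps]
def ShortComplex.mapChainComplexMap {K L : ChainComplex C ℕ} (φ : K ⟶ L) :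
    S.mapChainComplex K ⟶ S.mapChainComplex L where
  τ₁ := (S.X₁.mapHomologicalComplex _).map φ
  τ₂ := (S.X₂.mapHomologicalComplex _).map φ
  τ₃ := (S.X₃.mapHomologicalComplex _).map φ
  comm₁₂ := (NatTrans.mapHomologicalComplex S.f _).naturality φ
  comm₂₃ := (NatTrans.mapHomologicalComplex S.g _).naturality φ

/-- A short complex of functors which is short exact on projective objects. -/
def ShortComplex.ShortExactOnProjectives (S : ShortComplex (C ⥤ D)) : Prop :=
  ∀ (X : C) [Projective X], (S.map ((evaluation C D).obj X)).ShortExact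

variable {S}

lemma ShortComplex.ShortExactOnProjectives.mapChainComplex (hS : S.ShortExactOnProjectives)
    {X : C} (P : ProjectiveResolution X) : (S.mapChainComplex P.complex).ShortExact :=
  HomologicalComplex.shortExact_of_degreewise_shortExact _ fun n => hS (P.complex.X n)

/-- The connecting morphism in the homology sequence obtained by applying a short exact sequence
of functors to a projective resolution. -/
noncomputable def homologyδ (hS : S.ShortExactOnProjectives) {X : C} (P : ProjectiveResolution X)
    (n : ℕ) :
    (HomologicalComplex.homologyFunctor D _ (n + 1)).obj
        ((S.X₃.mapHomologicalComplex _).obj P.complex) ⟶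
      (HomologicalComplex.homologyFunctor D _ n).obj
        ((S.X₁.mapHomologicalComplex _).obj P.complex) :=
  (hS.mapChainComplex P).δ (n + 1) n (by simp)

lemma homologyδ_naturality (hS : S.ShortExactOnProjectives) {X Y : C} (P : ProjectiveResolution X)
    (Q : ProjectiveResolution Y) (φ : P.complex ⟶ Q.complex) (n : ℕ) :
    homologyδ hS P n ≫ (S.X₁.mapHomologicalComplex _ ⋙
        HomologicalComplex.homologyFunctor D _ n).map φ =
      (S.X₃.mapHomologicalComplex _ ⋙ HomologicalComplex.homologyFunctor D _ (n + 1)).map φ ≫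
        homologyδ hS Q n :=
  HomologicalComplex.HomologySequence.δ_naturality (S.mapChainComplexMap φ)
    (hS.mapChainComplex P) (hS.mapChainComplex Q) (n + 1) n (by simp)

variable [HasProjectiveResolutions C]

/-- The connecting natural transformation between left derived functors. -/
noncomputable def leftDerivedδ (hS : S.ShortExactOnProjectives) (n : ℕ) :
    S.X₃.leftDerived (n + 1) ⟶ S.X₁.leftDerived n where
  app X := ((projectiveResolution X).isoLeftDerivedObj S.X₃ (n + 1)).hom ≫
    homologyδ hS (projectiveResolution X) n ≫
      ((projectiveResolution X).isoLeftDerivedObj S.X₁ n).inv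
  naturality X Y f := by
    have comm : (ProjectiveResolution.lift f (projectiveResolution X)
        (projectiveResolution Y)).f 0 ≫ (projectiveResolution Y).π.f 0 =
          (projectiveResolution X).π.f 0 ≫ f := ProjectiveResolution.lift_commutes_zero _ _ _
    rw [ProjectiveResolution.isoLeftDerivedObj_hom_naturality_assoc f _ _ _ comm, Category.assoc,
      Category.assoc, ProjectiveResolution.isoLeftDerivedObj_inv_naturality f _ _ _ comm,
      ← reassoc_of% homologyδ_naturality hS]
    rfl

lemma exact_of_isos {A B E A' B' E' : D} {f : A ⟶ B} {g : B ⟶ E} {f' : A' ⟶ B'} {g' : B' ⟶ E'}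
    (w : f' ≫ g' = 0) (h : (ShortComplex.mk f' g' w).Exact)
    (a : A ≅ A') (b : B ≅ B') (e : E ≅ E')
    (hf : f = a.hom ≫ f' ≫ b.inv) (hg : g = b.hom ≫ g' ≫ e.inv) :
    ∃ w : f ≫ g = 0, (ShortComplex.mk f g w).Exact := by
  have w' : f ≫ g = 0 := by simp [hf, hg, reassoc_of% w]
  exact ⟨w', ShortComplex.exact_of_iso (ShortComplex.isoMk a.symm b.symm e.symm
    (by simp [hf]) (by simp [hg])) h⟩

/-- Exactness of `Lₙ₊₁ S.X₃ ⟶ Lₙ S.X₁ ⟶ Lₙ S.X₂`. -/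
lemma leftDerivedδ_exact (hS : S.ShortExactOnProjectives) (n : ℕ) (X : C) :
    ∃ w : (leftDerivedδ hS n).app X ≫ (NatTrans.leftDerived S.f n).app X = 0,
      (ShortComplex.mk _ _ w).Exact :=
  exact_of_isos _ ((hS.mapChainComplex (projectiveResolution X)).homology_exact₁ (n + 1) n
      (by simp)) ((projectiveResolution X).isoLeftDerivedObj S.X₃ (n + 1))
    ((projectiveResolution X).isoLeftDerivedObj S.X₁ n)
    ((projectiveResolution X).isoLeftDerivedObj S.X₂ n) rfl
    (ProjectiveResolution.leftDerived_app_eq S.f _ n)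

/-- Exactness of `Lₙ S.X₁ ⟶ Lₙ S.X₂ ⟶ Lₙ S.X₃`. -/
lemma leftDerived_exact (hS : S.ShortExactOnProjectives) (n : ℕ) (X : C) :
    ∃ w : (NatTrans.leftDerived S.f n).app X ≫ (NatTrans.leftDerived S.g n).app X = 0,
      (ShortComplex.mk _ _ w).Exact :=
  exact_of_isos _ ((hS.mapChainComplex (projectiveResolution X)).homology_exact₂ n)
    ((projectiveResolution X).isoLeftDerivedObj S.X₁ n)
    ((projectiveResolution X).isoLeftDerivedObj S.X₂ n)
    ((projectiveResolution X).isoLeftDerivedObj S.X₃ n)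
    (ProjectiveResolution.leftDerived_app_eq S.f _ n)
    (ProjectiveResolution.leftDerived_app_eq S.g _ n)

end LeftDerived

section Ext

variable {R : Type u} [CommRing R]

/-- The short complex of functors `Hom(-, S.X₃)ᵒᵖ ⟶ Hom(-, S.X₂)ᵒᵖ ⟶ Hom(-, S.X₁)ᵒᵖ`. -/
noncomputable def ShortComplex.linearYonedaOp (S : ShortComplex (ModuleCat.{u} R)) :
    ShortComplex (ModuleCat.{u} R ⥤ (ModuleCat.{u} R)ᵒᵖ) where
  X₁ := ((linearYoneda R (ModuleCat.{u} R)).obj S.X₃).rightOp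
  X₂ := ((linearYoneda R (ModuleCat.{u} R)).obj S.X₂).rightOp
  X₃ := ((linearYoneda R (ModuleCat.{u} R)).obj S.X₁).rightOp
  f := NatTrans.rightOp ((linearYoneda R (ModuleCat.{u} R)).map S.g)
  g := NatTrans.rightOp ((linearYoneda R (ModuleCat.{u} R)).map S.f)
  zero := by
    ext X
    apply Quiver.Hom.unop_inj
    ext (x : X ⟶ S.X₁) : 2
    exact (Category.assoc x S.f S.g).trans ((congrArg _ S.zero).trans comp_zero)

instance (S : ShortComplex (ModuleCat.{u} R)) : S.linearYonedaOp.X₁.Additive :=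
  inferInstanceAs ((linearYoneda R (ModuleCat.{u} R)).obj S.X₃).rightOp.Additive

instance (S : ShortComplex (ModuleCat.{u} R)) : S.linearYonedaOp.X₂.Additive :=
  inferInstanceAs ((linearYoneda R (ModuleCat.{u} R)).obj S.X₂).rightOp.Additive

instance (S : ShortComplex (ModuleCat.{u} R)) : S.linearYonedaOp.X₃.Additive :=
  inferInstanceAs ((linearYoneda R (ModuleCat.{u} R)).obj S.X₁).rightOp.Additive

lemma ShortComplex.ShortExact.linearYonedaOp {S : ShortComplex (ModuleCat.{u} R)}
    (hS : S.ShortExact) : S.linearYonedaOp.ShortExactOnProjectives := by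
  intro X _
  have := hS.mono_f
  have := hS.epi_g
  have key : (ShortComplex.mk ((linearYoneda R (ModuleCat.{u} R)).map S.f |>.app (Opposite.op X))
      ((linearYoneda R (ModuleCat.{u} R)).map S.g |>.app (Opposite.op X))
      (by ext (x : X ⟶ S.X₁) : 2
          exact (Category.assoc x S.f S.g).trans ((congrArg _ S.zero).trans comp_zero))).ShortExact :=
    { exact := by
        rw [ShortComplex.moduleCat_exact_iff]
        intro (x : X ⟶ S.X₂) (hx : x ≫ S.g = 0)
        exact ⟨hS.exact.lift x hx, hS.exact.lift_f x hx⟩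
      mono_f := by
        rw [ModuleCat.mono_iff_injective]
        intro (x : X ⟶ S.X₁) (y : X ⟶ S.X₁) (h : x ≫ S.f = y ≫ S.f)
        exact (cancel_mono S.f).1 h
      epi_g := by
        rw [ModuleCat.epi_iff_surjective]
        intro (x : X ⟶ S.X₃)
        exact ⟨Projective.factorThru x S.g, Projective.factorThru_comp x S.g⟩ }
  exact key.op

/-- The connecting natural transformation between `Ext` functors induced by a short exact
sequence in the covariant variable. -/
noncomputable def extδ {S : ShortComplex (ModuleCat.{u} R)} (hS : S.ShortExact) (n : ℕ) :
    (Ext R (ModuleCat.{u} R) n).flip.obj S.X₃ ⟶ (Ext R (ModuleCat.{u} R) (n + 1)).flip.obj S.X₁ :=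
  NatTrans.leftOp (leftDerivedδ hS.linearYonedaOp n)

lemma exact_extδ {S : ShortComplex (ModuleCat.{u} R)} (hS : S.ShortExact) (n : ℕ)
    (X : (ModuleCat.{u} R)ᵒᵖ) :
    Function.Exact (((Ext R (ModuleCat.{u} R) n).flip.map S.g).app X) ((extδ hS n).app X) := by
  obtain ⟨w, h⟩ := leftDerivedδ_exact hS.linearYonedaOp n X.unop
  exact (ShortComplex.ShortExact.moduleCat_exact_iff_function_exact _).1 h.unop

lemma exact_ext_map {S : ShortComplex (ModuleCat.{u} R)} (hS : S.ShortExact) (n : ℕ)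
    (X : (ModuleCat.{u} R)ᵒᵖ) :
    Function.Exact (((Ext R (ModuleCat.{u} R) n).flip.map S.f).app X)
      (((Ext R (ModuleCat.{u} R) n).flip.map S.g).app X) := by
  obtain ⟨w, h⟩ := leftDerived_exact hS.linearYonedaOp n X.unop
  exact (ShortComplex.ShortExact.moduleCat_exact_iff_function_exact _).1 h.unop

end Ext

section FilteredColimits

variable {R : Type u} [CommRing R] {J : Type} [SmallCategory J] [IsFiltered J]
  {F G H : J ⥤ ModuleCat.{u} R} (α : F ⟶ G) (β : G ⟶ H)
  {cF : Cocone F} {cG : Cocone G} {cH : Cocone H}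

lemma exact_map_of_isColimit (hF : IsColimit cF) (hG : IsColimit cG) (hH : IsColimit cH)
    (h : ∀ j, Function.Exact (α.app j) (β.app j)) :
    Function.Exact (hF.map cG α) (hG.map cH β) := by
  have := preservesFilteredColimitsOfSize_shrink.{0, u, 0, u} (forget (ModuleCat.{u} R))
  have hα (j : J) (x : F.obj j) : hF.map cG α (cF.ι.app j x) = cG.ι.app j (α.app j x) :=
    ConcreteCategory.congr_hom (hF.ι_map cG α j) x
  have hβ (j : J) (x : G.obj j) : hG.map cH β (cG.ι.app j x) = cH.ι.app j (β.app j x) :=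
    ConcreteCategory.congr_hom (hG.ι_map cH β j) x
  intro y
  constructor
  · intro hy
    obtain ⟨j, y, rfl⟩ := Concrete.isColimit_exists_rep G hG y
    have hz : cH.ι.app j (β.app j y) = cH.ι.app j (0 : H.obj j) := by
      rw [← hβ, hy, map_zero]
    obtain ⟨k, f, g, hfg⟩ := Concrete.isColimit_exists_of_rep_eq H hH _ _ hz
    have : β.app k (G.map f y) = 0 := by
      rw [NatTrans.naturality_apply, hfg, map_zero]
    obtain ⟨x, hx⟩ := (h k _).1 this
    exact ⟨cF.ι.app k x, by rw [hα, hx, ← ConcreteCategory.comp_apply, cG.w]⟩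
  · rintro ⟨x, rfl⟩
    obtain ⟨j, x, rfl⟩ := Concrete.isColimit_exists_rep F hF x
    rw [hα, hβ, (h j _).2 ⟨x, rfl⟩, map_zero]

lemma finite_of_exact_of_isColimit [IsNoetherianRing R]
    (hF : IsColimit cF) (hG : IsColimit cG) (hH : IsColimit cH)
    (h : ∀ j, Function.Exact (α.app j) (β.app j))
    [Module.Finite R cF.pt] [Module.Finite R cH.pt] : Module.Finite R cG.pt := by
  have := (exact_map_of_isColimit α β hF hG hH h).linearMap_ker_eq (f := (hF.map cG α).hom)
    (g := (hG.map cH β).hom)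
  have := isNoetherian_of_range_eq_ker _ _ this.symm
  infer_instance

end FilteredColimits

section ProjectiveDimension

variable {R : Type u} [CommRing R]

lemma hasProjectiveDimensionLE_of_subsingleton_ext (X : ModuleCat.{u} R) (n : ℕ)
    (h : ∀ (L : ModuleCat.{u} R) (j : ℕ), n < j →
      Subsingleton (((Ext R (ModuleCat.{u} R) j).obj (op X)).obj L)) :
    HasProjectiveDimensionLE X n := by
  rw [HasProjectiveDimensionLE, hasProjectiveDimensionLT_iff]
  rintro (_ | i) hi Y e
  · lia
  let P := projectiveResolution X
  obtain ⟨f, hf, rfl⟩ := P.extMk_surjective e _ rfl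
  rw [P.extMk_eq_zero_iff _ _ _ _ i rfl]
  have hz : IsZero ((P.complex.linearYonedaObj R Y).homology (i + 1)) :=
    .of_iso (@ModuleCat.isZero_of_subsingleton _ _ _ (h Y (i + 1) (by lia)))
      (P.isoExt (R := R) (i + 1) Y).symm
  rw [← HomologicalComplex.exactAt_iff_isZero_homology,
    HomologicalComplex.exactAt_iff' _ i (i + 1) (i + 2) (by simp) (by simp),
    ShortComplex.moduleCat_exact_iff] at hz
  exact hz f hf

end ProjectiveDimension

end CategoryTheory

namespace localCohomology

variable {R : Type u} [CommRing R] (𝔞 : Ideal R)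

/-- The colimit cocone over `t ↦ Ext i (R ⧸ 𝔞 ^ t) M` with point the local cohomology of `M`. -/
noncomputable def cocone (i : ℕ) (M : ModuleCat.{u} R) :
    Cocone ((ringModIdeals (idealPowersDiagram 𝔞)).op ⋙
      (Ext R (ModuleCat.{u} R) i).flip.obj M) :=
  ((evaluation _ _).obj M).mapCocone (colimit.cocone (diagram (idealPowersDiagram 𝔞) i))

/-- `localCohomology.cocone` is a colimit cocone. -/
noncomputable def coconeIsColimit (i : ℕ) (M : ModuleCat.{u} R) :
    IsColimit (cocone 𝔞 i M) :=
  isColimitOfPreserves ((evaluation _ _).obj M)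
    (colimit.isColimit (diagram (idealPowersDiagram 𝔞) i))

variable [IsNoetherianRing R] {S : ShortComplex (ModuleCat.{u} R)}

lemma finite_obj_X₂ (hS : S.ShortExact) (i : ℕ)
    (h₁ : Module.Finite R ((localCohomology 𝔞 i).obj S.X₁))
    (h₃ : Module.Finite R ((localCohomology 𝔞 i).obj S.X₃)) :
    Module.Finite R ((localCohomology 𝔞 i).obj S.X₂) :=
  have : Module.Finite R (cocone 𝔞 i S.X₁).pt := h₁
  have : Module.Finite R (cocone 𝔞 i S.X₃).pt := h₃
  finite_of_exact_of_isColimit (Functor.whiskerLeft _ ((Ext R _ i).flip.map S.f))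
    (Functor.whiskerLeft _ ((Ext R _ i).flip.map S.g)) (coconeIsColimit 𝔞 i S.X₁)
    (coconeIsColimit 𝔞 i S.X₂) (coconeIsColimit 𝔞 i S.X₃) fun _ => exact_ext_map hS i _

lemma finite_obj_X₃ (hS : S.ShortExact) (i : ℕ)
    (h₂ : Module.Finite R ((localCohomology 𝔞 i).obj S.X₂))
    (h₁ : Module.Finite R ((localCohomology 𝔞 (i + 1)).obj S.X₁)) :
    Module.Finite R ((localCohomology 𝔞 i).obj S.X₃) :=
  have : Module.Finite R (cocone 𝔞 i S.X₂).pt := h₂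
  have : Module.Finite R (cocone 𝔞 (i + 1) S.X₁).pt := h₁
  finite_of_exact_of_isColimit (Functor.whiskerLeft _ ((Ext R _ i).flip.map S.g))
    (Functor.whiskerLeft _ (extδ hS i)) (coconeIsColimit 𝔞 i S.X₂)
    (coconeIsColimit 𝔞 i S.X₃) (coconeIsColimit 𝔞 (i + 1) S.X₁) fun _ => exact_extδ hS i _

omit [IsNoetherianRing R] in
lemma finite_of_retract {M N : ModuleCat.{u} R} (r : Retract M N) (i : ℕ)
    (h : Module.Finite R ((localCohomology 𝔞 i).obj N)) :
    Module.Finite R ((localCohomology 𝔞 i).obj M) :=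
  Module.Finite.of_surjective ((localCohomology 𝔞 i).map r.r).hom fun x =>
    ⟨(localCohomology 𝔞 i).map r.i x, by
      exact ConcreteCategory.congr_hom (r.map (localCohomology 𝔞 i)).retract x⟩

lemma finite_pi (i : ℕ) (h : Module.Finite R ((localCohomology 𝔞 i).obj (ModuleCat.of R R)))
    (m : ℕ) : Module.Finite R ((localCohomology 𝔞 i).obj (ModuleCat.of R (Fin m → R))) := by
  induction m with
  | zero => exact finite_of_retract 𝔞 ⟨0, 0, (ModuleCat.isZero_of_subsingleton _).eq_of_src _ _⟩ i h
  | succ m ih =>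
    let f : (Fin m → R) →ₗ[R] R × (Fin m → R) := LinearMap.inr R R _
    let g : R × (Fin m → R) →ₗ[R] R := LinearMap.fst R R _
    have hS : (ModuleCat.shortComplexOfCompEqZero f g (by ext; simp [f, g])).ShortExact :=
      ModuleCat.shortComplex_shortExact _ .inr_fst LinearMap.inr_injective LinearMap.fst_surjective
    exact finite_of_retract 𝔞 (.ofIso (Fin.consLinearEquiv R (fun _ => R)).symm.toModuleIso) i
      (finite_obj_X₂ 𝔞 hS i ih h)

lemma finite_of_hasProjectiveDimensionLE (n : ℕ) (N : ModuleCat.{u} R) [Module.Finite R N]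
    (hN : HasProjectiveDimensionLE N n) (i : ℕ)
    (h : ∀ j ≤ i + n, Module.Finite R ((localCohomology 𝔞 j).obj (ModuleCat.of R R))) :
    Module.Finite R ((localCohomology 𝔞 i).obj N) := by
  induction n generalizing N i with
  | zero =>
    have : Projective N := (projective_iff_hasProjectiveDimensionLE_zero N).2 hN
    obtain ⟨m, p, hp⟩ := Module.Finite.exists_fin' R N
    have : Epi (ModuleCat.ofHom p) := (ModuleCat.epi_iff_surjective _).2 hp
    exact finite_of_retract 𝔞 ⟨Projective.factorThru (𝟙 N) (ModuleCat.ofHom p), ModuleCat.ofHom p,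
      Projective.factorThru_comp _ _⟩ i (finite_pi 𝔞 i (h i (by lia)) m)
  | succ n ih =>
    obtain ⟨m, p, hp⟩ := Module.Finite.exists_fin' R N
    have hS := LinearMap.shortExact_shortComplexKer hp
    have hK := (hS.hasProjectiveDimensionLT_X₃_iff n
      (ModuleCat.projective_of_free (Pi.basisFun R (Fin m)))).1 hN
    exact finite_obj_X₃ 𝔞 hS i (finite_pi 𝔞 i (h i (by lia)) m)
      (ih _ hK (i + 1) fun j hj => h j (by lia))

end localCohomology

theorem finiteness_dim_ge_of_finite_projective_dimension
    {R : Type u} [CommRing R] [IsNoetherianRing R]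
    (𝔞 : Ideal R) (N : Type u) [AddCommGroup N] [Module R N] [Module.Finite R N] (n : ℕ)
    (h_pd_le : ∀ (L : ModuleCat.{u} R) (j : ℕ), n < j →
      Subsingleton (((Ext R (ModuleCat.{u} R) j).obj (op (ModuleCat.of R N))).obj L))
    (h_pd_eq : ∃ L : ModuleCat.{u} R,
      Nontrivial (((Ext R (ModuleCat.{u} R) n).obj (op (ModuleCat.of R N))).obj L)) :
    ∀ i : ℕ, (∀ j ≤ i + n, Module.Finite R ((localCohomology 𝔞 j).obj (ModuleCat.of R R))) →
      Module.Finite R ((localCohomology 𝔞 i).obj (ModuleCat.of R N)) :=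
  localCohomology.finite_of_hasProjectiveDimensionLE 𝔞 n (ModuleCat.of R N)
    (hasProjectiveDimensionLE_of_subsingleton_ext _ n h_pd_le)
end
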